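/- arXiv:math/0606685 — 4 statements merged into one kernel-verified Lean document; each statement's English description precedes it below -/
import Mathlib

section
/- Let 0 < α < 2 and p ∈ (0, α+1) with p ≠ 1, and let x ∈ ℝ, x ≠ 0. Then the principal value limit lim_{ε↓0} ∫_{{x' ∈ ℝ : |x'−x| > ε}} (|x'|^{p−1} − |x|^{p−1}) / |x−x'|^{1+α} dx' exists and equals γ(α,p)·|x|^{p−α−1}. -/
open MeasureTheory Filter Set

theorem rpow_bd (s : ℝ) : ∃ C : ℝ, 0 ≤ C ∧ ∀ t : ℝ, |t| ≤ 1/2 → |(1+t)^s - 1| ≤ C * |t| := by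
  have hc : ContinuousOn (fun t : ℝ => s * (1+t)^(s-1)) (Icc (-(1/2)) (1/2)) := by
    apply ContinuousOn.mul continuousOn_const
    apply ContinuousOn.rpow_const (by fun_prop)
    intro t ht
    left
    have := ht.1
    intro h
    linarith
  obtain ⟨C, hC⟩ := isCompact_Icc.exists_bound_of_continuousOn hc
  have h0 : (0:ℝ) ∈ Icc (-(1/2):ℝ) (1/2) := by constructor <;> norm_num
  refine ⟨C, (norm_nonneg _).trans (hC 0 h0), fun t ht => ?_⟩
  have ht' := abs_le.mp ht
  have := Convex.norm_image_sub_le_of_norm_hasDerivWithin_le (f := fun t : ℝ => (1+t)^s)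
    (f' := fun t : ℝ => s * (1+t)^(s-1)) (C := C) (s := Icc (-(1/2)) (1/2)) ?_ hC (convex_Icc _ _)
    h0 (y := t) ⟨ht'.1, ht'.2⟩
  · simpa [Real.norm_eq_abs] using this
  · intro y hy
    have h1 : HasDerivAt (fun t : ℝ => 1 + t) 1 y := by simpa using (hasDerivAt_id y).const_add 1
    have := h1.rpow_const (p := s) (Or.inl (by have := hy.1; intro h; linarith))
    simpa using this.hasDerivWithinAt

theorem rpow_bd2 (s : ℝ) : ∃ C : ℝ, 0 ≤ C ∧ ∀ t : ℝ, 0 ≤ t → t ≤ 1/2 →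
    |(1+t)^s + (1-t)^s - 2| ≤ C * t^2 := by
  obtain ⟨C, hC0, hC⟩ := rpow_bd (s-1)
  refine ⟨|s| * (2 * C), by positivity, fun t ht0 ht => ?_⟩
  have := Convex.norm_image_sub_le_of_norm_hasDerivWithin_le (f := fun t : ℝ => (1+t)^s + (1-t)^s)
    (f' := fun t : ℝ => s * ((1+t)^(s-1) - (1-t)^(s-1))) (C := |s| * (2 * C) * t) (s := Icc 0 t)
    ?_ ?_ (convex_Icc _ _)
    (x := 0) (by simp [ht0]) (y := t) (by simp [ht0])
  · have e : (1+t)^s + (1-t)^s - 2 = (1+t)^s + (1-t)^s - ((1+0)^s + (1-0)^s) := by norm_num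
    rw [e]
    simp only [Real.norm_eq_abs, sub_zero, abs_of_nonneg ht0] at this
    calc _ ≤ _ := by simpa using this
      _ = _ := by ring
  · intro y hy
    have h1 : HasDerivAt (fun t : ℝ => 1 + t) 1 y := by simpa using (hasDerivAt_id y).const_add 1
    have h2 : HasDerivAt (fun t : ℝ => 1 - t) (-1) y := by simpa using (hasDerivAt_id y).const_sub 1
    have h3 := h1.rpow_const (p := s) (Or.inl (by have := hy.1; intro h; linarith))
    have h4 := h2.rpow_const (p := s) (Or.inl (by have := hy.2; intro h; linarith))
    have := (h3.add h4).hasDerivWithinAt (s := Icc 0 t)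
    refine this.congr_deriv ?_
    ring
  · intro y hy
    have a1 := hC y (by rw [abs_of_nonneg hy.1]; exact hy.2.trans ht)
    have a2 := hC (-y) (by rw [abs_neg, abs_of_nonneg hy.1]; exact hy.2.trans ht)
    rw [abs_neg] at a2
    rw [abs_of_nonneg hy.1, ] at a1 a2
    rw [Real.norm_eq_abs, abs_mul, mul_assoc]
    gcongr
    have : (1+y)^(s-1) - (1-y)^(s-1) = ((1+y)^(s-1) - 1) - ((1+-y)^(s-1) - 1) := by
      rw [← sub_eq_add_neg]; ring
    rw [this]
    refine (abs_sub _ _).trans ?_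
    have := mul_le_mul_of_nonneg_left hy.2 hC0
    linarith

theorem ii_abs (a : ℝ) (ha : -1 < a) (x y : ℝ) :
    IntervalIntegrable (fun v : ℝ => |v|^a) volume x y := by
  have key : ∀ c : ℝ, IntervalIntegrable (fun v : ℝ => |v|^a) volume 0 c := by
    have pos : ∀ c : ℝ, 0 ≤ c → IntervalIntegrable (fun v : ℝ => |v|^a) volume 0 c := by
      intro c hc
      refine (intervalIntegral.intervalIntegrable_rpow' ha (a := 0) (b := c)).congr ?_
      intro v hv
      rw [uIoc_of_le hc] at hv
      simp [abs_of_pos hv.1]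
    intro c
    rcases le_total 0 c with hc | hc
    · exact pos c hc
    · have := (IntervalIntegrable.iff_comp_neg enorm_ne_top).mp (pos (-c) (by linarith))
      simpa using this
  exact (key x).symm.trans (key y)

theorem ii_P (a b : ℝ) (ha : -1 < a) (hb : -1 < b) (x y : ℝ) :
    IntervalIntegrable (fun v : ℝ => |v|^a * |v-1|^b) volume x y := by
  have key : ∀ c : ℝ, IntervalIntegrable (fun v : ℝ => |v|^a * |v-1|^b) volume (1/2) c := by
    intro c
    rcases le_total (1/2) c with hc | hc
    · apply IntervalIntegrable.continuousOn_mul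
      · simpa using (ii_abs b hb (1/2-1) (c-1)).comp_sub_right 1
      · apply ContinuousOn.rpow_const (by fun_prop)
        intro v hv
        rw [uIcc_of_le hc] at hv
        left
        have := hv.1
        exact abs_ne_zero.mpr (by intro h; linarith)
    · apply IntervalIntegrable.mul_continuousOn
      · exact ii_abs a ha _ _
      · apply ContinuousOn.rpow_const (by fun_prop)
        intro v hv
        rw [uIcc_of_ge hc] at hv
        left
        have := hv.2
        exact abs_ne_zero.mpr (by intro h; linarith)
  exact (key x).symm.trans (key y)

theorem cov (α p x ε : ℝ) (hx : x ≠ 0) (hε : 0 < ε) :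
    ∫ x' in {x' : ℝ | ε < |x' - x|}, (|x'| ^ (p - 1) - |x| ^ (p - 1)) / |x - x'| ^ (1 + α)
    = |x|^(p-α-1) * ∫ v in (1-|x|/ε)..(1+|x|/ε), (|v|^(p-1) * |v-1|^(α-p) - |v-1|^(α-1)) := by
  have hx' : 0 < |x| := abs_pos.mpr hx
  set N := |x|/ε with hN
  have hNpos : 0 < N := by positivity
  have himg : {x' : ℝ | ε < |x' - x|} = (fun v : ℝ => x + x/(v-1)) '' (Ioo (1-N) (1+N) \ {1}) := by
    ext y
    simp only [mem_ofPred_eq, mem_image, Set.mem_sdiff, mem_Ioo, mem_singleton_iff]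
    constructor
    · intro h
      have hy : y - x ≠ 0 := by intro h0; rw [h0] at h; simp at h; linarith
      refine ⟨1 + x/(y-x), ⟨?_, ?_⟩, ?_⟩
      · have : |x/(y-x)| < N := by
          rw [abs_div, hN]
          exact div_lt_div_of_pos_left hx' hε h
        have := abs_lt.mp this
        constructor <;> linarith [this.1, this.2]
      · simp [hx, hy]
      · rw [add_sub_cancel_left, div_div_cancel₀ hx]
        ring
    · rintro ⟨v, ⟨⟨h1, h2⟩, h3⟩, rfl⟩
      have h4 : 0 < |v-1| := abs_pos.mpr (sub_ne_zero.mpr h3)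
      have h5 : |v-1| < N := abs_lt.mpr ⟨by linarith, by linarith⟩
      rw [add_sub_cancel_left, abs_div, lt_div_iff₀ h4]
      rw [hN, lt_div_iff₀ hε] at h5
      linarith
  have hder : ∀ v ∈ (Ioo (1-N) (1+N) \ {1} : Set ℝ),
      HasDerivWithinAt (fun v : ℝ => x + x/(v-1)) (-x/(v-1)^2) (Ioo (1-N) (1+N) \ {1}) v := by
    intro v hv
    have hv1 : v - 1 ≠ 0 := sub_ne_zero.mpr hv.2
    have h1 : HasDerivAt (fun t : ℝ => t - 1) 1 v := by simpa using (hasDerivAt_id v).sub_const 1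
    have := ((hasDerivAt_const v x).div h1 hv1).const_add x
    refine this.hasDerivWithinAt.congr_deriv ?_
    simp
  have hinj : InjOn (fun v : ℝ => x + x/(v-1)) (Ioo (1-N) (1+N) \ {1}) := by
    intro v hv w hw h
    have hv1 : v - 1 ≠ 0 := sub_ne_zero.mpr hv.2
    have hw1 : w - 1 ≠ 0 := sub_ne_zero.mpr hw.2
    replace h : x/(v-1) = x/(w-1) := by
      have h' : x + x/(v-1) = x + x/(w-1) := h
      linarith
    field_simp at h
    linarith
  rw [himg, integral_image_eq_integral_abs_deriv_smul (measurableSet_Ioo.diff (measurableSet_singleton _)) hder hinj]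
  have hset : (Ioo (1-N) (1+N) \ {1} : Set ℝ) =ᵐ[volume] Ioc (1-N) (1+N) :=
    (sdiff_null_ae_eq_self (by simp)).trans Ioo_ae_eq_Ioc
  rw [intervalIntegral.integral_of_le (by linarith), ← setIntegral_congr_set hset,
    ← integral_const_mul]
  apply setIntegral_congr_fun (measurableSet_Ioo.diff (measurableSet_singleton _))
  intro v hv
  have hv1 : v - 1 ≠ 0 := sub_ne_zero.mpr hv.2
  have hw : 0 < |v-1| := abs_pos.mpr hv1
  have e1 : x + x/(v-1) = x * v / (v-1) := by field_simp; ring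
  have e2 : x - (x + x/(v-1)) = -(x/(v-1)) := by ring
  simp only [smul_eq_mul]
  rw [e2, e1, abs_neg, abs_div, abs_div, abs_div, abs_neg, abs_mul, abs_pow]
  generalize |v-1| = w at *
  generalize |x| = X at *
  have hV : 0 ≤ |v| := abs_nonneg v
  generalize |v| = V at *
  rw [Real.div_rpow (by positivity) hw.le, Real.div_rpow hx'.le hw.le, Real.mul_rpow hx'.le hV]
  have f1 : X^(p-α-1) = X^(p-1) * X / X^(1+α) := by
    rw [← Real.rpow_add_one hx'.ne', ← Real.rpow_sub hx']; congr 1; ring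
  have f2 : w^(α-p) = w^(1+α) / (w^2 * w^(p-1)) := by
    rw [← Real.rpow_natCast, ← Real.rpow_add hw, ← Real.rpow_sub hw]; congr 1; push_cast; ring
  have f3 : w^(α-1) = w^(1+α) / w^2 := by
    rw [← Real.rpow_natCast, ← Real.rpow_sub hw]; congr 1; push_cast; ring
  rw [f1, f2, f3]
  have := Real.rpow_pos_of_pos hx' (1+α)
  have := Real.rpow_pos_of_pos hw (1+α)
  have := Real.rpow_pos_of_pos hw (p-1)
  field_simp

theorem int_sub (α N : ℝ) (hα : 0 < α) (hN : 0 ≤ N) :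
    ∫ v in (1-N)..(1+N), |v-1|^(α-1) = 2 * N^α / α := by
  rw [intervalIntegral.integral_comp_sub_right (fun v => |v|^(α-1)) 1]
  have e1 : ∫ v in (0:ℝ)..N, |v|^(α-1) = N^α/α := by
    have : ∫ v in (0:ℝ)..N, |v|^(α-1) = ∫ v in (0:ℝ)..N, v^(α-1) := by
      apply intervalIntegral.integral_congr
      intro v hv
      rw [uIcc_of_le hN] at hv
      simp [abs_of_nonneg hv.1]
    rw [this, integral_rpow (Or.inl (by linarith))]
    simp [hα.ne']
  have e2 : ∫ v in (-N)..0, |v|^(α-1) = N^α/α := by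
    have := intervalIntegral.integral_comp_neg (a := 0) (b := N) (fun v => |v|^(α-1))
    simp only [abs_neg, neg_zero] at this
    rw [← this, e1]
  have h := ii_abs (α-1) (by linarith)
  have : (1 - N - 1) = -N := by ring
  rw [this, add_sub_cancel_left, ← intervalIntegral.integral_add_adjacent_intervals (h _ 0) (h _ _), e1, e2]
  ring

theorem int_split (a b N : ℝ) (ha : -1 < a) (hb : -1 < b) :
    ∫ v in (1-N)..(1+N), |v|^a * |v-1|^b
    = (∫ v in (0:ℝ)..N, (|v|^a * |v-1|^b + |v|^a * |v+1|^b))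
      + ∫ v in N..(N+1), (|v|^a * |v-1|^b - |v-1|^a * |v|^b) := by
  have h := ii_P a b ha hb
  have h' : ∀ x y : ℝ, IntervalIntegrable (fun v : ℝ => |v|^a * |v+1|^b) volume x y := by
    intro x y
    have := (IntervalIntegrable.iff_comp_neg enorm_ne_top).mp (h (-x) (-y))
    simp only [neg_neg, abs_neg] at this
    refine this.congr ?_
    intro v _
    have : -v - 1 = -(v+1) := by ring
    simp only [this, abs_neg]
  have h'' : ∀ x y : ℝ, IntervalIntegrable (fun v : ℝ => |v-1|^a * |v|^b) volume x y := by
    intro x y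
    simpa using (h' (x-1) (y-1)).comp_sub_right 1
  rw [intervalIntegral.integral_add (h _ _) (h' _ _), intervalIntegral.integral_sub (h _ _) (h'' _ _)]
  have e1 : ∫ v in (1-N)..0, |v|^a * |v-1|^b = ∫ v in (0:ℝ)..(N-1), |v|^a * |v+1|^b := by
    have := intervalIntegral.integral_comp_neg (a := 0) (b := N-1) (fun v => |v|^a * |v-1|^b)
    rw [neg_zero, neg_sub] at this
    rw [← this]
    congr 1
    ext v
    have : -v - 1 = -(v+1) := by ring
    rw [this, abs_neg, abs_neg]
  have e2 : ∫ v in N..(N+1), |v-1|^a * |v|^b = ∫ v in (N-1)..N, |v|^a * |v+1|^b := by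
    have := intervalIntegral.integral_comp_sub_right (a := N) (b := N+1) (fun v => |v|^a * |v+1|^b) 1
    simpa using this
  rw [← intervalIntegral.integral_add_adjacent_intervals (h _ 0) (h _ _), e1, e2, add_comm 1 N,
    ← intervalIntegral.integral_add_adjacent_intervals (h 0 N) (h _ (N+1)),
    ← intervalIntegral.integral_add_adjacent_intervals (h' 0 (N-1)) (h' _ N)]
  ring

theorem rpow_bd3 (s r : ℝ) : ∃ C : ℝ, 0 ≤ C ∧ ∀ t u : ℝ, 0 ≤ t → t ≤ 1/2 → |u| = t →
    |(1-t)^s - (1+u)^r| ≤ C * t := by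
  obtain ⟨C, hC0, hC⟩ := rpow_bd s
  obtain ⟨D, hD0, hD⟩ := rpow_bd r
  refine ⟨C + D, by positivity, fun t u h0 h1 hu => ?_⟩
  have a1 := hC (-t) (by rwa [abs_neg, abs_of_nonneg h0])
  have a2 := hD u (by rwa [hu])
  rw [abs_neg, abs_of_nonneg h0, ← sub_eq_add_neg] at a1
  rw [hu] at a2
  have : (1-t)^s - (1+u)^r = ((1-t)^s - 1) - ((1+u)^r - 1) := by ring
  rw [this]
  refine (abs_sub _ _).trans ?_
  linarith

theorem h_int (α p : ℝ) (hα2 : α < 2) (hp0 : 0 < p) (hp1 : p < α + 1) :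
    IntegrableOn (fun v : ℝ => v ^ (p - 2) * (|v - 1| ^ (α - p) - (v + 1) ^ (α - p))) (Ioi 0) := by
  obtain ⟨C, hC0, hC⟩ := rpow_bd3 (α-p) (α-p)
  have hm : Measurable (fun v : ℝ => v ^ (p - 2) * (|v - 1| ^ (α - p) - (v + 1) ^ (α - p))) := by
    fun_prop
  have e : Ioi (0:ℝ) = Ioc 0 (1/2) ∪ (Ioc (1/2) 2 ∪ Ioi 2) := by
    rw [Ioc_union_Ioi_eq_Ioi (by norm_num), Ioc_union_Ioi_eq_Ioi (by norm_num)]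
  rw [e]
  refine IntegrableOn.union ?_ (IntegrableOn.union ?_ ?_)
  · have h1 : IntegrableOn (fun v : ℝ => C * v^(p-1)) (Ioc 0 (1/2)) := by
      have := (intervalIntegral.intervalIntegrable_rpow' (a := 0) (b := 1/2) (r := p-1) (by linarith)).const_mul C
      rwa [intervalIntegrable_iff_integrableOn_Ioc_of_le (by norm_num)] at this
    refine h1.mono' hm.aestronglyMeasurable ?_
    refine (ae_restrict_iff' measurableSet_Ioc).mpr (ae_of_all _ fun v hv => ?_)
    have hv0 : 0 < v := hv.1
    have := hC v v hv.1.le hv.2 (abs_of_pos hv0)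
    rw [Real.norm_eq_abs, abs_mul, abs_of_pos (Real.rpow_pos_of_pos hv0 _), abs_sub_comm v 1,
      abs_of_nonneg (by linarith [hv.2] : 0 ≤ 1 - v), add_comm v 1]
    calc _ ≤ v^(p-2) * (C * v) := by gcongr
      _ = C * (v^(p-2) * v) := by ring
      _ = _ := by rw [← Real.rpow_add_one hv0.ne']; congr 2; ring
  · have : IntervalIntegrable (fun v : ℝ => v ^ (p - 2) * (|v - 1| ^ (α - p) - (v + 1) ^ (α - p))) volume (1/2) 2 := by
      apply IntervalIntegrable.continuousOn_mul
      · apply IntervalIntegrable.sub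
        · simpa using (ii_abs (α-p) (by linarith) (1/2-1) (2-1)).comp_sub_right 1
        · apply ContinuousOn.intervalIntegrable
          apply ContinuousOn.rpow_const (by fun_prop)
          intro v hv
          rw [uIcc_of_le (by norm_num)] at hv
          left
          linarith [hv.1]
      · apply ContinuousOn.rpow_const (by fun_prop)
        intro v hv
        rw [uIcc_of_le (by norm_num)] at hv
        left
        linarith [hv.1]
    rwa [intervalIntegrable_iff_integrableOn_Ioc_of_le (by norm_num)] at this
  · have h1 : IntegrableOn (fun v : ℝ => C * v^(α-3)) (Ioi 2) :=
      (integrableOn_Ioi_rpow_of_lt (by linarith) (by norm_num)).const_mul C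
    refine h1.mono' hm.aestronglyMeasurable ?_
    refine (ae_restrict_iff' measurableSet_Ioi).mpr (ae_of_all _ fun v hv => ?_)
    have hv2 : 2 < v := hv
    have hv0 : 0 < v := by linarith
    have ht : 1/v ≤ 1/2 := by gcongr
    have := hC (1/v) (1/v) (by positivity) ht (abs_of_nonneg (by positivity))
    have f1 : v - 1 = v * (1 - 1/v) := by field_simp
    have f2 : v + 1 = v * (1 + 1/v) := by field_simp
    rw [Real.norm_eq_abs, abs_mul, abs_of_pos (Real.rpow_pos_of_pos hv0 _),
      abs_of_nonneg (by linarith : 0 ≤ v - 1), f1, f2, Real.mul_rpow hv0.le (by linarith),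
      Real.mul_rpow hv0.le (by positivity), ← mul_sub, abs_mul, abs_of_pos (Real.rpow_pos_of_pos hv0 _)]
    calc _ ≤ v^(p-2) * (v^(α-p) * (C * (1/v))) := by gcongr
      _ = C * (v^(p-2) * v^(α-p) / v) := by ring
      _ = _ := by rw [← Real.rpow_add hv0, ← Real.rpow_sub_one hv0.ne']; congr 2; ring

theorem rem1 (α p : ℝ) (hα2 : α < 2) :
    Tendsto (fun N : ℝ => ∫ v in N..(N+1), (|v|^(p-1) * |v-1|^(α-p) - |v-1|^(p-1) * |v|^(α-p)))
      atTop (nhds 0) := by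
  obtain ⟨C, hC0, hC⟩ := rpow_bd3 (α-p) (p-1)
  have hlim : Tendsto (fun N : ℝ => C * N^(α-2)) atTop (nhds 0) := by
    have := (tendsto_rpow_neg_atTop (by linarith : 0 < 2 - α)).const_mul C
    simpa using this
  refine squeeze_zero_norm' ?_ hlim
  filter_upwards [eventually_ge_atTop 2] with N hN
  have := intervalIntegral.norm_integral_le_of_norm_le_const (a := N) (b := N+1) (C := C * N^(α-2))
    (f := fun v => (|v|^(p-1) * |v-1|^(α-p) - |v-1|^(p-1) * |v|^(α-p))) ?_
  · simpa using this
  intro v hv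
  rw [uIoc_of_le (by linarith)] at hv
  have hv2 : 2 < v := lt_of_le_of_lt hN hv.1
  have hv0 : 0 < v := by linarith
  have ht : 1/v ≤ 1/2 := by gcongr
  have := hC (1/v) (-(1/v)) (by positivity) ht (by rw [abs_neg]; exact abs_of_nonneg (by positivity))
  rw [← sub_eq_add_neg] at this
  have f1 : v - 1 = v * (1 - 1/v) := by field_simp
  rw [abs_of_nonneg (by linarith : 0 ≤ v - 1), abs_of_pos hv0, f1, Real.mul_rpow hv0.le (by linarith),
    Real.mul_rpow hv0.le (by linarith)]
  have g : v^(p-1) * (v^(α-p) * (1 - 1/v)^(α-p)) - v^(p-1) * (1 - 1/v)^(p-1) * v^(α-p)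
     = (v^(p-1) * v^(α-p)) * ((1 - 1/v)^(α-p) - (1 - 1/v)^(p-1)) := by ring
  rw [g, ← Real.rpow_add hv0, Real.norm_eq_abs, abs_mul, abs_of_pos (Real.rpow_pos_of_pos hv0 _)]
  calc _ ≤ v^(p-1+(α-p)) * (C * (1/v)) := by gcongr
    _ = C * (v^(p-1+(α-p)) / v) := by ring
    _ = C * v^(α-2) := by rw [← Real.rpow_sub_one hv0.ne']; congr 2; ring
    _ ≤ C * N^(α-2) := by
      gcongr ?_ * ?_
      exact Real.rpow_le_rpow_of_nonpos (by linarith) hv.1.le (by linarith)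

noncomputable def FF (α p v : ℝ) : ℝ :=
  v^(p-1) * ((max (v-1) 0)^(α-p+1) - (max (1-v) 0)^(α-p+1) + (v+1)^(α-p+1))

theorem rem2 (α p : ℝ) (hα2 : α < 2) (hp1 : p < α + 1) :
    Tendsto (fun N : ℝ => FF α p N - 2 * N^α) atTop (nhds 0) := by
  obtain ⟨C, hC0, hC⟩ := rpow_bd2 (α-p+1)
  have hlim : Tendsto (fun N : ℝ => C * N^(α-2)) atTop (nhds 0) := by
    have := (tendsto_rpow_neg_atTop (by linarith : 0 < 2 - α)).const_mul C
    simpa using this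
  refine squeeze_zero_norm' ?_ hlim
  filter_upwards [eventually_ge_atTop 2] with v hv2
  have hv0 : 0 < v := by linarith
  have ht : 1/v ≤ 1/2 := by gcongr
  have := hC (1/v) (by positivity) ht
  have f1 : v - 1 = v * (1 - 1/v) := by field_simp
  have f2 : v + 1 = v * (1 + 1/v) := by field_simp
  unfold FF
  rw [max_eq_left (by linarith : (0:ℝ) ≤ v - 1), max_eq_right (by linarith : 1 - v ≤ 0),
    Real.zero_rpow (by linarith), f1, f2, Real.mul_rpow hv0.le (by linarith),
      Real.mul_rpow hv0.le (by positivity)]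
  have e : v^α = v^(p-1) * v^(α-p+1) := by rw [← Real.rpow_add hv0]; congr 1; ring
  have g : v^(p-1) * (v^(α-p+1) * (1 - 1/v)^(α-p+1) - 0 + v^(α-p+1) * (1+1/v)^(α-p+1)) - 2 * v^α
     = v^α * ((1 + 1/v)^(α-p+1) + (1 - 1/v)^(α-p+1) - 2) := by rw [e]; ring
  rw [g, Real.norm_eq_abs, abs_mul, abs_of_pos (Real.rpow_pos_of_pos hv0 _)]
  calc _ ≤ v^α * (C * (1/v)^2) := by gcongr
    _ = C * (v^α / v^2) := by ring
    _ = C * v^(α-2) := by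
      rw [← Real.rpow_natCast v 2, ← Real.rpow_sub hv0]; norm_num

theorem FF_cont (α p N : ℝ) (hp0 : 0 < p) (hp1 : p < α + 1) :
    ContinuousOn (FF α p) (Icc 0 N) := by
  intro v hv
  rcases eq_or_lt_of_le hv.1 with h | h
  · subst h
    obtain ⟨C, hC0, hC⟩ := rpow_bd3 (α-p+1) (α-p+1)
    have h0 : FF α p 0 = 0 := by
      simp [FF, Real.zero_rpow (by linarith : α - p + 1 ≠ 0)]
    rw [ContinuousWithinAt, h0]
    have hlim : Tendsto (fun v : ℝ => C * v^p) (nhdsWithin 0 (Icc 0 N)) (nhds 0) := by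
      have : ContinuousAt (fun v : ℝ => C * v^p) 0 :=
        continuousAt_const.mul (Real.continuousAt_rpow_const _ _ (Or.inr hp0.le))
      have := this.tendsto
      simp only [Real.zero_rpow hp0.ne', mul_zero] at this
      exact this.mono_left nhdsWithin_le_nhds
    refine squeeze_zero_norm' ?_ hlim
    filter_upwards [self_mem_nhdsWithin,
      mem_nhdsWithin_of_mem_nhds (Iic_mem_nhds (by norm_num : (0:ℝ) < 1/2))] with v hv hv2
    have hv2' : v ≤ 1/2 := hv2
    rcases eq_or_lt_of_le hv.1 with h | h
    · rw [← h, h0]; simp [Real.zero_rpow hp0.ne']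
    have := hC v v hv.1 hv2' (abs_of_nonneg hv.1)
    unfold FF
    rw [max_eq_right (by linarith : v - 1 ≤ 0), max_eq_left (by linarith : 0 ≤ 1 - v),
      Real.zero_rpow (by linarith), Real.norm_eq_abs, abs_mul, abs_of_pos (Real.rpow_pos_of_pos h _),
      zero_sub, add_comm v 1, ← abs_neg, neg_add, neg_neg, ← sub_eq_add_neg]
    calc _ ≤ v^(p-1) * (C * v) := by gcongr
      _ = C * (v^(p-1) * v) := by ring
      _ = _ := by rw [← Real.rpow_add_one h.ne']; congr 2; ring
  · apply ContinuousAt.continuousWithinAt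
    unfold FF
    have hb : 0 ≤ α - p + 1 := by linarith
    refine (Real.continuousAt_rpow_const _ _ (Or.inl h.ne')).mul ?_
    refine ((ContinuousAt.rpow_const (by fun_prop) (Or.inr hb)).sub
      (ContinuousAt.rpow_const (by fun_prop) (Or.inr hb))).add
      (ContinuousAt.rpow_const (by fun_prop) (Or.inr hb))

theorem FF_deriv (α p v : ℝ) (hp1 : p < α + 1) (h0 : 0 < v) (h1 : v ≠ 1) :
    HasDerivAt (FF α p) (α * (|v|^(p-1) * |v-1|^(α-p) + |v|^(p-1) * |v+1|^(α-p))
      - (p-1) * (v ^ (p - 2) * (|v - 1| ^ (α - p) - (v + 1) ^ (α - p)))) v := by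
  have hb : α - p + 1 ≠ 0 := by linarith
  have d0 : HasDerivAt (fun v : ℝ => v^(p-1)) ((p-1) * v^(p-2)) v := by
    have := Real.hasDerivAt_rpow_const (x := v) (p := p-1) (Or.inl h0.ne')
    refine this.congr_deriv ?_
    congr 2; ring
  have dp : HasDerivAt (fun t : ℝ => (t+1)^(α-p+1)) ((α-p+1) * (v+1)^(α-p)) v := by
    have h1 : HasDerivAt (fun t : ℝ => t + 1) 1 v := by simpa using (hasDerivAt_id v).add_const 1
    have := h1.rpow_const (p := α-p+1) (Or.inl (by linarith))
    refine this.congr_deriv ?_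
    rw [one_mul, add_sub_cancel_right]
  have e2 : v^(p-1) = v * v^(p-2) := by
    rw [mul_comm, ← Real.rpow_add_one h0.ne']; congr 1; ring
  have q : (v+1)^(α-p+1) = (v+1)^(α-p) * (v+1) := Real.rpow_add_one (by linarith) _
  rw [abs_of_pos h0, abs_of_pos (by linarith : 0 < v+1)]
  rcases lt_or_gt_of_ne h1 with h | h
  · have dm : HasDerivAt (fun t : ℝ => -(1-t)^(α-p+1)) ((α-p+1) * (1-v)^(α-p)) v := by
      have h1 : HasDerivAt (fun t : ℝ => 1 - t) (-1) v := by simpa using (hasDerivAt_id v).const_sub 1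
      have := (h1.rpow_const (p := α-p+1) (Or.inl (by linarith))).fun_neg
      refine this.congr_deriv ?_
      rw [add_sub_cancel_right]; ring
    have q2 : (1-v)^(α-p+1) = (1-v)^(α-p) * (1-v) := Real.rpow_add_one (by linarith) _
    have D := d0.fun_mul (dm.fun_add dp)
    have : FF α p =ᶠ[nhds v] fun t => t^(p-1) * (-(1-t)^(α-p+1) + (t+1)^(α-p+1)) := by
      filter_upwards [Iio_mem_nhds h] with t ht
      have ht' : t < 1 := ht
      unfold FF
      rw [max_eq_right (by linarith : t - 1 ≤ 0), max_eq_left (by linarith : 0 ≤ 1 - t),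
        Real.zero_rpow hb, zero_sub]
    refine (D.congr_of_eventuallyEq this).congr_deriv ?_
    rw [abs_of_neg (by linarith : v - 1 < 0), neg_sub, q, q2, e2]
    ring
  · have dm : HasDerivAt (fun t : ℝ => (t-1)^(α-p+1)) ((α-p+1) * (v-1)^(α-p)) v := by
      have h1 : HasDerivAt (fun t : ℝ => t - 1) 1 v := by simpa using (hasDerivAt_id v).sub_const 1
      have := (h1.rpow_const (p := α-p+1) (Or.inl (by linarith)))
      refine this.congr_deriv ?_
      rw [add_sub_cancel_right]; ring
    have q2 : (v-1)^(α-p+1) = (v-1)^(α-p) * (v-1) := Real.rpow_add_one (by linarith) _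
    have D := d0.fun_mul (dm.fun_add dp)
    have : FF α p =ᶠ[nhds v] fun t => t^(p-1) * ((t-1)^(α-p+1) + (t+1)^(α-p+1)) := by
      filter_upwards [Ioi_mem_nhds h] with t ht
      have ht' : 1 < t := ht
      unfold FF
      rw [max_eq_left (by linarith : 0 ≤ t - 1), max_eq_right (by linarith : 1 - t ≤ 0),
        Real.zero_rpow hb, sub_zero]
    refine (D.congr_of_eventuallyEq this).congr_deriv ?_
    rw [abs_of_pos (by linarith : 0 < v - 1), q, q2, e2]
    ring

theorem parts (α p N : ℝ) (hα0 : 0 < α) (hα2 : α < 2) (hp0 : 0 < p) (hp1 : p < α + 1) (hN : 0 ≤ N) :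
    ∫ v in (0:ℝ)..N, (|v|^(p-1) * |v-1|^(α-p) + |v|^(p-1) * |v+1|^(α-p))
    = (p-1)/α * (∫ v in (0:ℝ)..N, v ^ (p - 2) * (|v - 1| ^ (α - p) - (v + 1) ^ (α - p)))
      + FF α p N / α := by
  have hh : IntervalIntegrable (fun v : ℝ => v ^ (p - 2) * (|v - 1| ^ (α - p) - (v + 1) ^ (α - p)))
      volume 0 N := by
    rw [intervalIntegrable_iff_integrableOn_Ioc_of_le hN]
    exact (h_int α p hα2 hp0 hp1).mono_set Ioc_subset_Ioi_self
  have h := ii_P (p-1) (α-p) (by linarith) (by linarith)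
  have h' : ∀ x y : ℝ, IntervalIntegrable (fun v : ℝ => |v|^(p-1) * |v+1|^(α-p)) volume x y := by
    intro x y
    have := (IntervalIntegrable.iff_comp_neg enorm_ne_top).mp (h (-x) (-y))
    simp only [neg_neg, abs_neg] at this
    refine this.congr ?_
    intro v _
    have : -v - 1 = -(v+1) := by ring
    simp only [this, abs_neg]
  have hk := (h 0 N).add (h' 0 N)
  have := integral_eq_of_hasDerivAt_off_countable (a := 0) (b := N) (FF α p) _ (countable_singleton (1:ℝ))
    (by rw [uIcc_of_le hN]; exact FF_cont α p N hp0 hp1)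
    (fun v hv => by
      rw [min_eq_left hN, max_eq_right hN] at hv
      exact FF_deriv α p v hp1 hv.1.1 hv.2)
    ((hk.const_mul α).sub (hh.const_mul (p-1)))
  have h0 : FF α p 0 = 0 := by
    simp [FF, Real.zero_rpow (by linarith : α - p + 1 ≠ 0)]
  rw [intervalIntegral.integral_sub (hk.const_mul α) (hh.const_mul (p-1)),
    intervalIntegral.integral_const_mul, intervalIntegral.integral_const_mul, h0, sub_zero] at this
  rw [← this]
  generalize (∫ v in (0:ℝ)..N, (|v|^(p-1) * |v-1|^(α-p) + |v|^(p-1) * |v+1|^(α-p))) = A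
  field_simp
  ring

/-- For `0 < α < 2`, `p ∈ (0, α+1)`, `p ≠ 1` and `x ≠ 0`, the principal value
limit `lim_{ε↓0} ∫_{|x'-x|>ε} (|x'|^{p-1} - |x|^{p-1}) / |x-x'|^{1+α} dx'` exists and equals
`γ(α,p) · |x|^{p-α-1}`, where
`γ(α,p) = ((p-1)/α) ∫₀^∞ v^{p-2} (|v-1|^{α-p} - (v+1)^{α-p}) dv`. -/
theorem stmt0 (α p x : ℝ) (hα0 : 0 < α) (hα2 : α < 2)
    (hp0 : 0 < p) (hp1 : p < α + 1) (hpne : p ≠ 1) (hx : x ≠ 0) :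
    Tendsto
      (fun ε : ℝ => ∫ x' in {x' : ℝ | ε < |x' - x|},
        (|x'| ^ (p - 1) - |x| ^ (p - 1)) / |x - x'| ^ (1 + α))
      (nhdsWithin 0 (Ioi 0))
      (nhds
        (((p - 1) / α *
            ∫ v in Ioi (0 : ℝ),
              v ^ (p - 2) * (|v - 1| ^ (α - p) - (v + 1) ^ (α - p))) *
          |x| ^ (p - α - 1))) := by
  have hx' : 0 < |x| := abs_pos.mpr hx
  have hN : Tendsto (fun ε : ℝ => |x|/ε) (nhdsWithin 0 (Ioi 0)) atTop := by
    simpa [div_eq_mul_inv] using tendsto_inv_nhdsGT_zero.const_mul_atTop hx'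
  have L1 := intervalIntegral_tendsto_integral_Ioi 0 (h_int α p hα2 hp0 hp1) tendsto_id
  have L2 := ((L1.const_mul ((p-1)/α)).add ((rem2 α p hα2 hp1).div_const α)).add (rem1 α p hα2)
  have L3 := (L2.comp hN).mul_const (|x|^(p-α-1))
  simp only [zero_div, add_zero] at L3
  refine L3.congr' ?_
  filter_upwards [self_mem_nhdsWithin] with ε hε
  have hε' : 0 < ε := hε
  have hN0 : 0 ≤ |x|/ε := by positivity
  rw [cov α p x ε hx hε', intervalIntegral.integral_sub
    (ii_P (p-1) (α-p) (by linarith) (by linarith) _ _)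
    (by simpa only [sub_add_cancel] using
      (ii_abs (α-1) (by linarith) (1-|x|/ε-1) (1+|x|/ε-1)).comp_sub_right 1),
    int_sub α _ hα0 hN0, int_split _ _ _ (by linarith) (by linarith),
    parts α p _ hα0 hα2 hp0 hp1 hN0]
  simp only [Function.comp, id]
  ring
end

section
/- Let 0 < α < 2 and let x ∈ ℝ, x ≠ 0. Then the principal value limit lim_{ε↓0} ∫_{{x' ∈ ℝ : |x'−x| > ε}} (ln|x'| − ln|x|) / |x−x'|^{1+α} dx' exists and equals γ(α,1)·|x|^{−α}. -/
open MeasureTheory Filter Set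

lemma ii_abs_rpow {r : ℝ} (hr : -1 < r) (a b : ℝ) :
    IntervalIntegrable (fun s : ℝ => |s| ^ r) volume a b := by
  have pos : ∀ c : ℝ, 0 ≤ c → IntervalIntegrable (fun s : ℝ => |s| ^ r) volume 0 c := by
    intro c hc
    refine (intervalIntegral.intervalIntegrable_rpow' (a := 0) (b := c) hr).congr ?_
    intro s hs
    rw [uIoc_of_le hc] at hs
    simp only [abs_of_pos hs.1]
  have all : ∀ c : ℝ, IntervalIntegrable (fun s : ℝ => |s| ^ r) volume 0 c := by
    intro c
    rcases le_total 0 c with hc | hc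
    · exact pos c hc
    · have := (IntervalIntegrable.iff_comp_neg (by simp)).1 (pos (-c) (by linarith))
      simpa using this
  exact (all a).symm.trans (all b)

lemma abs_log_bound {β : ℝ} (hβ : 0 < β) (s : ℝ) (hs : s ≠ 0) :
    |Real.log s| ≤ |s| ^ (-β) / β + |s| ^ β / β := by
  have hp : 0 < |s| := abs_pos.2 hs
  rw [← Real.log_abs]
  have h1 := Real.log_le_rpow_div hp.le hβ
  have h2 := Real.log_le_rpow_div (inv_pos.2 hp).le hβ
  rw [Real.log_inv, Real.inv_rpow hp.le, ← Real.rpow_neg hp.le] at h2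
  have h3 : 0 ≤ |s| ^ (-β) / β := by positivity
  have h4 : 0 ≤ |s| ^ β / β := by positivity
  rw [abs_le]; constructor <;> linarith

lemma ii1 {α : ℝ} (hα0 : 0 < α) (a b : ℝ) :
    IntervalIntegrable (fun s : ℝ => |s| ^ (α - 1) * Real.log s) volume a b := by
  have hI : IntervalIntegrable (fun s : ℝ => |s| ^ (α / 2 - 1) / (α / 2)
      + |s| ^ (α * 3 / 2 - 1) / (α / 2)) volume a b :=
    ((ii_abs_rpow (by linarith) a b).div_const _).add ((ii_abs_rpow (by linarith) a b).div_const _)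
  refine hI.mono_fun' (by fun_prop) ?_
  have h0 : ∀ᵐ s : ℝ ∂(volume.restrict (uIoc a b)), s ≠ 0 :=
    ae_restrict_of_ae (by simp [ae_iff])
  filter_upwards [h0] with s hs
  have hp : 0 < |s| := abs_pos.2 hs
  have hb := abs_log_bound (β := α / 2) (by linarith) s hs
  have e1 : |s| ^ (α / 2 - 1) = |s| ^ (α - 1) * |s| ^ (-(α / 2)) := by
    rw [← Real.rpow_add hp]; ring_nf
  have e2 : |s| ^ (α * 3 / 2 - 1) = |s| ^ (α - 1) * |s| ^ (α / 2) := by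
    rw [← Real.rpow_add hp]; ring_nf
  rw [norm_mul, Real.norm_eq_abs, Real.norm_eq_abs, abs_of_nonneg (by positivity : 0 ≤ |s| ^ (α - 1)),
    e1, e2]
  have : 0 ≤ |s| ^ (α - 1) := by positivity
  calc _ ≤ _ := mul_le_mul_of_nonneg_left hb this
    _ = _ := by ring

lemma ii2 {α : ℝ} (hα0 : 0 < α) (hα2 : α < 2) (a b : ℝ) :
    IntervalIntegrable (fun s : ℝ => |s| ^ (α - 1) * Real.log (s + 1)) volume a b := by
  have hl : IntervalIntegrable (fun s : ℝ => |Real.log (s + 1)|) volume a b := by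
    have := ((intervalIntegral.intervalIntegrable_log' (a := a + 1) (b := b + 1))).comp_add_right 1
      (by simp)
    simpa using this.norm
  have hI : IntervalIntegrable (fun s : ℝ => |s| ^ (α - 1)
      + (2 + |s|) * |Real.log (s + 1)|) volume a b :=
    (ii_abs_rpow (by linarith) a b).add (hl.continuousOn_mul (by fun_prop))
  refine hI.mono_fun' (by fun_prop) (ae_of_all _ fun s => ?_)
  have hn : 0 ≤ |s| ^ (α - 1) := by positivity
  simp only [norm_mul, Real.norm_eq_abs, abs_of_nonneg hn]
  rcases le_total |s| (1 / 2) with h | h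
  · have h' := abs_le.1 h
    have : |Real.log (s + 1)| ≤ 1 := by
      rw [abs_le]
      constructor
      · have := Real.one_sub_inv_le_log_of_pos (x := s + 1) (by linarith)
        have h3 : (s + 1)⁻¹ ≤ (1 / 2)⁻¹ := inv_anti₀ (by norm_num) (by linarith)
        norm_num at h3
        linarith
      · have := Real.log_le_sub_one_of_pos (x := s + 1) (by linarith)
        linarith
    have h5 : 0 ≤ (2 + |s|) * |Real.log (s + 1)| := by positivity
    nlinarith
  · have hp : 0 < |s| := by linarith
    have : |s| ^ (α - 1) ≤ 2 + |s| := by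
      rcases le_total |s| 1 with h1 | h1
      · have := Real.rpow_le_rpow_of_exponent_ge hp h1 (by linarith : (-1 : ℝ) ≤ α - 1)
        rw [Real.rpow_neg_one] at this
        have h3 : |s|⁻¹ ≤ (1 / 2)⁻¹ := inv_anti₀ (by norm_num) (by linarith)
        norm_num at h3
        linarith
      · have := Real.rpow_le_rpow_of_exponent_le h1 (by linarith : α - 1 ≤ (1 : ℝ))
        rw [Real.rpow_one] at this
        linarith
    have := mul_le_mul_of_nonneg_right this (abs_nonneg (Real.log (s + 1)))
    linarith

lemma ii3 {α : ℝ} (hα0 : 0 < α) (hα2 : α < 2) (a b : ℝ) :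
    IntervalIntegrable (fun s : ℝ => |s - 1| ^ (α - 1) * Real.log s) volume a b := by
  have := (ii2 hα0 hα2 (a - 1) (b - 1)).comp_sub_right 1 enorm_ne_top
  simpa using this

lemma ii4 {α : ℝ} (hα0 : 0 < α) (hα2 : α < 2) (a b : ℝ) :
    IntervalIntegrable (fun s : ℝ => |s + 1| ^ (α - 1) * Real.log s) volume a b := by
  have := (IntervalIntegrable.iff_comp_neg enorm_ne_top).1 (ii3 hα0 hα2 (-a) (-b))
  have e : ∀ s : ℝ, |-s - 1| = |s + 1| := fun s => by rw [← abs_neg]; congr 1; ring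
  simpa [e] using this

/-- first difference bound -/
lemma diff_bound {r u v : ℝ} (hr : |r| ≤ 1) (hu : 0 < u) (huv : u ≤ v) :
    |v ^ r - u ^ r| ≤ u ^ (r - 1) * (v - u) := by
  have h := Convex.norm_image_sub_le_of_norm_hasDerivWithin_le (f := fun w : ℝ => w ^ r)
    (f' := fun w => r * w ^ (r - 1)) (s := Ici u) (x := u) (y := v) (C := u ^ (r - 1))
    (fun w hw => (Real.hasDerivAt_rpow_const (Or.inl (by have : u ≤ w := hw; linarith))).hasDerivWithinAt)
    (fun w hw => by
      have hw' : u ≤ w := hw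
      have h1 : w ^ (r - 1) ≤ u ^ (r - 1) :=
        Real.rpow_le_rpow_of_nonpos hu hw' (by have := (abs_le.1 hr).2; linarith)
      have h2 : 0 ≤ w ^ (r - 1) := Real.rpow_nonneg (by linarith) _
      rw [norm_mul, Real.norm_eq_abs, Real.norm_eq_abs, abs_of_nonneg h2]
      nlinarith [abs_nonneg r])
    (convex_Ici u) (self_mem_Ici) huv
  simpa [Real.norm_eq_abs, abs_of_nonneg (sub_nonneg.2 huv)] using h

noncomputable def gfun (α v : ℝ) : ℝ := v⁻¹ * (|v - 1| ^ (α - 1) - (v + 1) ^ (α - 1))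

lemma g_int {α : ℝ} (hα0 : 0 < α) (hα2 : α < 2) : IntegrableOn (gfun α) (Ioi 0) := by
  have hm : Measurable (gfun α) := by unfold gfun; fun_prop
  have hr : |α - 1| ≤ 1 := abs_le.2 ⟨by linarith, by linarith⟩
  rw [← Ioc_union_Ioi_eq_Ioi (show (0 : ℝ) ≤ 2 by norm_num)]
  refine IntegrableOn.union ?_ ?_
  · have hI : IntervalIntegrable (fun v : ℝ => 8 + 2 * (|v - 1| ^ (α - 1) + |v + 1| ^ (α - 1)))
        volume 0 2 := by
      have h1 := (ii_abs_rpow (r := α - 1) (by linarith) (-1) 1).comp_sub_right 1 (by simp)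
      have h2 := (ii_abs_rpow (r := α - 1) (by linarith) 1 3).comp_add_right 1 (by simp)
      norm_num at h1 h2
      exact intervalIntegrable_const.add ((h1.add h2).const_mul 2)
    have hI' := (intervalIntegrable_iff_integrableOn_Ioc_of_le (by norm_num)).1 hI
    refine Integrable.mono' hI' hm.aestronglyMeasurable ?_
    refine (ae_restrict_iff' measurableSet_Ioc).2 (ae_of_all _ fun v hv => ?_)
    obtain ⟨hv0, hv2⟩ := hv
    have ha : 0 ≤ |v - 1| ^ (α - 1) := by positivity
    have hb : 0 ≤ |v + 1| ^ (α - 1) := by positivity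
    have hvi : 0 < v⁻¹ := inv_pos.2 hv0
    unfold gfun
    rw [norm_mul, Real.norm_eq_abs, Real.norm_eq_abs, abs_of_pos hvi]
    rcases le_total v (1 / 2) with h | h
    · have e : |v - 1| = 1 - v := by rw [abs_sub_comm, abs_of_nonneg (by linarith)]
      have hd := diff_bound hr (show 0 < 1 - v by linarith) (show 1 - v ≤ v + 1 by linarith)
      have h4 : (1 - v) ^ (α - 1 - 1) ≤ 4 := by
        calc (1 - v) ^ (α - 1 - 1) ≤ (1 / 2 : ℝ) ^ (α - 1 - 1) :=
              Real.rpow_le_rpow_of_nonpos (by norm_num) (by linarith) (by linarith)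
          _ ≤ (1 / 2 : ℝ) ^ (-2 : ℝ) :=
              Real.rpow_le_rpow_of_exponent_ge (by norm_num) (by norm_num) (by linarith)
          _ = 4 := by rw [Real.rpow_neg (by norm_num)]; norm_num
      rw [abs_sub_comm] at hd
      have h8 : |(1 - v) ^ (α - 1) - (v + 1) ^ (α - 1)| ≤ 8 * v := by nlinarith
      have h9 : v⁻¹ * |(1 - v) ^ (α - 1) - (v + 1) ^ (α - 1)| ≤ 8 := by
        rw [inv_mul_le_iff₀ hv0]; linarith
      rw [e] at ha ⊢
      linarith
    · have h3 : v⁻¹ ≤ 2 := by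
        have h3 : v⁻¹ ≤ (1 / 2)⁻¹ := inv_anti₀ (by norm_num) h
        norm_num at h3
        exact h3
      rw [abs_of_pos (show 0 < v + 1 by linarith)] at *
      have h5 : |(|v - 1| ^ (α - 1) - (v + 1) ^ (α - 1))| ≤
          |v - 1| ^ (α - 1) + (v + 1) ^ (α - 1) := by
        rw [abs_le]; constructor <;> linarith
      calc _ ≤ 2 * (|v - 1| ^ (α - 1) + (v + 1) ^ (α - 1)) := by gcongr
        _ ≤ _ := by linarith
  · have hI : IntegrableOn (fun v : ℝ => 2 * (v ^ (α - 3) / 2 ^ (α - 3))) (Ioi 2) := by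
      have h := (integrableOn_Ioi_rpow_of_lt (a := α - 3) (c := 2) (by linarith) two_pos)
      exact (h.div_const _).const_mul 2
    refine Integrable.mono' hI hm.aestronglyMeasurable ?_
    refine (ae_restrict_iff' measurableSet_Ioi).2 (ae_of_all _ fun v hv => ?_)
    have hv : 2 < v := hv
    have hd := diff_bound hr (show 0 < v - 1 by linarith) (show v - 1 ≤ v + 1 by linarith)
    rw [abs_sub_comm] at hd
    have e : (v - 1) ^ (α - 1 - 1) = (v - 1) ^ (α - 3) * (v - 1) := by
      rw [← Real.rpow_add_one (by linarith)]; ring_nf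
    have hle : (v - 1) ^ (α - 3) ≤ v ^ (α - 3) / 2 ^ (α - 3) := by
      rw [← Real.div_rpow (by linarith) (by norm_num)]
      exact Real.rpow_le_rpow_of_nonpos (by linarith) (by linarith) (by linarith)
    have hp : 0 < (v - 1) ^ (α - 3) := Real.rpow_pos_of_pos (by linarith) _
    unfold gfun
    rw [norm_mul, Real.norm_eq_abs, Real.norm_eq_abs, abs_of_pos (inv_pos.2 (by linarith : 0 < v)),
      abs_of_pos (show 0 < v - 1 by linarith), inv_mul_le_iff₀ (by linarith)]
    rw [e] at hd
    nlinarith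

noncomputable def Afun (α u : ℝ) : ℝ := u * |u| ^ (α - 1)

lemma A_pos {α u : ℝ} (hu : 0 < u) : Afun α u = u ^ α := by
  unfold Afun
  rw [abs_of_pos hu, mul_comm, ← Real.rpow_add_one hu.ne']; ring_nf

lemma A_neg (α u : ℝ) : Afun α (-u) = - Afun α u := by
  unfold Afun; rw [abs_neg]; ring

lemma A_deriv {α u : ℝ} (hu : u ≠ 0) : HasDerivAt (Afun α) (α * |u| ^ (α - 1)) u := by
  have pos : ∀ w : ℝ, 0 < w → HasDerivAt (Afun α) (α * |w| ^ (α - 1)) w := by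
    intro w hw
    rw [abs_of_pos hw]
    refine (Real.hasDerivAt_rpow_const (p := α) (Or.inl hw.ne')).congr_of_eventuallyEq ?_
    filter_upwards [lt_mem_nhds hw] with z hz using A_pos hz
  rcases lt_or_gt_of_ne hu with h | h
  · have h1 := pos (-u) (by linarith)
    have h2 := (h1.comp u (hasDerivAt_neg u)).neg
    rw [abs_neg] at h2
    have e : -(Afun α ∘ Neg.neg) = Afun α := by
      funext z; simp [A_neg]
    have e2 : -(α * |u| ^ (α - 1) * -1) = α * |u| ^ (α - 1) := by ring
    rw [e2] at h2
    rw [e] at h2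
    exact h2
  · exact pos u h

lemma A_cont {α : ℝ} (hα0 : 0 < α) : Continuous (Afun α) := by
  rw [continuous_iff_continuousAt]
  intro u
  by_cases hu : u = 0
  · subst hu
    have h0 : Afun α 0 = 0 := by simp [Afun]
    rw [ContinuousAt, h0]
    have hc : Tendsto (fun u : ℝ => |u| ^ α) (nhds 0) (nhds 0) := by
      have : Continuous (fun u : ℝ => |u| ^ α) := continuous_abs.rpow_const (fun _ => Or.inr hα0.le)
      simpa [Real.zero_rpow hα0.ne'] using this.tendsto 0
    refine squeeze_zero_norm (fun u => ?_) hc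
    by_cases hu : u = 0
    · subst hu; simp [Afun, Real.zero_rpow hα0.ne']
    · have hp := abs_pos.2 hu
      unfold Afun
      rw [norm_mul, Real.norm_eq_abs, Real.norm_eq_abs, abs_of_nonneg (by positivity : 0 ≤ |u| ^ (α - 1)),
        mul_comm, ← Real.rpow_add_one hp.ne']
      ring_nf; rfl
  · exact (A_deriv hu).continuousAt

noncomputable def Mfun (α v : ℝ) : ℝ := (Afun α (v - 1) + Afun α (v + 1) - 2 * Afun α v) / α

noncomputable def Bfun (α v : ℝ) : ℝ := |v - 1| ^ (α - 1) + |v + 1| ^ (α - 1) - 2 * |v| ^ (α - 1)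

lemma M_cont {α : ℝ} (hα0 : 0 < α) : Continuous (Mfun α) := by
  have := A_cont hα0
  unfold Mfun; fun_prop

lemma M_deriv {α v : ℝ} (hα0 : 0 < α) (hv : 0 < v) (hv1 : v ≠ 1) :
    HasDerivAt (Mfun α) (Bfun α v) v := by
  have h1 := (A_deriv (α := α) (sub_ne_zero.2 hv1)).comp v ((hasDerivAt_id v).sub_const 1)
  have h2 := (A_deriv (α := α) (show v + 1 ≠ 0 by linarith)).comp v ((hasDerivAt_id v).add_const 1)
  have h3 := (A_deriv (α := α) hv.ne').const_mul 2
  have h := ((h1.add h2).sub h3).div_const α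
  refine h.congr_deriv ?_
  unfold Bfun
  field_simp

noncomputable def Pfun (α v : ℝ) : ℝ := Mfun α v * Real.log v - Mfun α v / α

lemma P_deriv {α v : ℝ} (hα0 : 0 < α) (hv : 0 < v) (hv1 : v ≠ 1) :
    HasDerivAt (Pfun α) (Bfun α v * Real.log v - gfun α v / α) v := by
  have hM := M_deriv hα0 hv hv1
  have h := (hM.mul (Real.hasDerivAt_log hv.ne')).sub (hM.div_const α)
  refine h.congr_deriv ?_
  unfold Bfun Mfun gfun Afun
  rw [abs_of_pos (show 0 < v + 1 by linarith), abs_of_pos hv]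
  field_simp
  ring

lemma M_zero (α : ℝ) : Mfun α 0 = 0 := by
  have : Afun α (-1) = - Afun α 1 := A_neg α 1
  have h0 : Afun α 0 = 0 := by simp [Afun]
  simp [Mfun, this, h0]

lemma P_cont0 {α : ℝ} (hα0 : 0 < α) : ContinuousWithinAt (Pfun α) (Ici 0) 0 := by
  rw [← continuousWithinAt_Ioi_iff_Ici]
  refine ContinuousWithinAt.sub ?_ ((M_cont hα0).div_const α).continuousWithinAt
  rw [ContinuousWithinAt, M_zero, zero_mul]
  have hk : HasDerivAt (fun v => Afun α (v - 1) + Afun α (v + 1)) (α * |(0 : ℝ) - 1| ^ (α - 1) * 1 +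
      α * |(0 : ℝ) + 1| ^ (α - 1) * 1) 0 := by
    have h1 := (A_deriv (α := α) (show (0 : ℝ) - 1 ≠ 0 by norm_num)).comp 0
      ((hasDerivAt_id (0 : ℝ)).sub_const 1)
    have h2 := (A_deriv (α := α) (show (0 : ℝ) + 1 ≠ 0 by norm_num)).comp 0
      ((hasDerivAt_id (0 : ℝ)).add_const 1)
    exact h1.add h2
  have hO := hk.isBigO_sub
  have h00 : Afun α (0 - 1) + Afun α (0 + 1) = 0 := by
    have : Afun α (-1) = - Afun α 1 := A_neg α 1
    simp [this]
  simp only [h00, sub_zero] at hO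
  have hO' := (hO.mono (nhdsWithin_le_nhds (s := Ioi (0 : ℝ)))).mul
    (Asymptotics.isBigO_refl Real.log (nhdsWithin 0 (Ioi 0)))
  have t1 : Tendsto (fun v : ℝ => v * Real.log v) (nhdsWithin 0 (Ioi 0)) (nhds 0) := by
    have := tendsto_log_mul_rpow_nhdsGT_zero one_pos
    simpa [mul_comm] using this
  have t2 := hO'.trans_tendsto t1
  have t3 := tendsto_log_mul_rpow_nhdsGT_zero hα0
  have t4 := (t2.sub (t3.const_mul 2)).div_const α
  simp only [mul_zero, sub_zero, zero_div] at t4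
  refine t4.congr' ?_
  filter_upwards [self_mem_nhdsWithin] with v hv
  unfold Mfun
  rw [A_pos (u := v) hv]
  ring

lemma P_contOn {α : ℝ} (hα0 : 0 < α) (S : ℝ) (hS : 0 ≤ S) : ContinuousOn (Pfun α) (uIcc 0 S) := by
  rw [uIcc_of_le hS]
  intro v hv
  rcases hv.1.eq_or_lt with h | h
  · subst h
    exact (P_cont0 hα0).mono Icc_subset_Ici_self
  · have hM := (M_cont hα0).continuousAt (x := v)
    exact ((hM.mul (Real.continuousAt_log h.ne')).sub (hM.div_const α)).continuousWithinAt

lemma B_ii {α : ℝ} (hα0 : 0 < α) (hα2 : α < 2) (a b : ℝ) :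
    IntervalIntegrable (fun v => Bfun α v * Real.log v) volume a b := by
  have := ((ii3 hα0 hα2 a b).add (ii4 hα0 hα2 a b)).sub ((ii1 hα0 a b).const_mul 2)
  refine this.congr (fun v _ => ?_)
  simp only [Bfun, Pi.add_apply, Pi.sub_apply]
  ring

lemma g_ii {α : ℝ} (hα0 : 0 < α) (hα2 : α < 2) (S : ℝ) (hS : 0 ≤ S) :
    IntervalIntegrable (gfun α) volume 0 S :=
  (intervalIntegrable_iff_integrableOn_Ioc_of_le hS).2 ((g_int hα0 hα2).mono_set Ioc_subset_Ioi_self)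

lemma B_integral {α : ℝ} (hα0 : 0 < α) (hα2 : α < 2) (S : ℝ) (hS : 0 ≤ S) :
    ∫ v in (0)..S, Bfun α v * Real.log v = Pfun α S + (∫ v in (0)..S, gfun α v) / α := by
  have h := integral_eq_of_hasDerivAt_off_countable (Pfun α)
    (fun v => Bfun α v * Real.log v - gfun α v / α) (a := 0) (b := S) (s := {1})
    (countable_singleton 1) (P_contOn hα0 S hS)
    (fun v hv => by
      rw [min_eq_left hS, max_eq_right hS] at hv
      exact P_deriv hα0 hv.1.1 (by simpa using hv.2))
    ((B_ii hα0 hα2 0 S).sub ((g_ii hα0 hα2 S hS).div_const α))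
  rw [intervalIntegral.integral_sub (B_ii hα0 hα2 0 S) ((g_ii hα0 hα2 S hS).div_const α),
    intervalIntegral.integral_div] at h
  have h0 : Pfun α 0 = 0 := by simp [Pfun, M_zero]
  linarith

lemma M_bound {α S : ℝ} (hα0 : 0 < α) (hα2 : α < 2) (hS : 1 < S) :
    |Mfun α S| ≤ (S - 1) ^ (α - 2) := by
  have hr : |α - 1| ≤ 1 := abs_le.2 ⟨by linarith, by linarith⟩
  have h := Convex.norm_image_sub_le_of_norm_hasDerivWithin_le
    (f := fun u : ℝ => Afun α (u + 1) - Afun α u)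
    (f' := fun u => α * |u + 1| ^ (α - 1) - α * |u| ^ (α - 1)) (s := Ici (S - 1)) (x := S - 1) (y := S)
    (C := α * (S - 1) ^ (α - 2))
    (fun w hw => by
      have hw' : S - 1 ≤ w := hw
      have h2 := (A_deriv (α := α) (show w + 1 ≠ 0 by linarith)).comp w
        ((hasDerivAt_id w).add_const 1)
      rw [mul_one] at h2
      exact (h2.sub (A_deriv (by linarith))).hasDerivWithinAt)
    (fun w hw => by
      have hw' : S - 1 ≤ w := hw
      have hd := diff_bound hr (show 0 < w by linarith) (show w ≤ w + 1 by linarith)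
      have h1 : w ^ (α - 2) ≤ (S - 1) ^ (α - 2) :=
        Real.rpow_le_rpow_of_nonpos (by linarith) hw' (by linarith)
      rw [show α - 1 - 1 = α - 2 by ring] at hd
      rw [← mul_sub, norm_mul, Real.norm_eq_abs, Real.norm_eq_abs, abs_of_pos hα0,
        abs_of_pos (show 0 < w by linarith), abs_of_pos (show 0 < w + 1 by linarith)]
      refine mul_le_mul_of_nonneg_left ?_ hα0.le
      linarith)
    (convex_Ici _) (self_mem_Ici) (by simp)
  simp only [Real.norm_eq_abs, sub_add_cancel, sub_sub_cancel, abs_one, mul_one] at h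
  have e : Mfun α S = (Afun α (S + 1) - Afun α S - (Afun α S - Afun α (S - 1))) / α := by
    unfold Mfun; ring
  rw [e, abs_div, abs_of_pos hα0, div_le_iff₀ hα0]
  linarith

lemma decay {α : ℝ} (hα2 : α < 2) (c : ℝ) :
    Tendsto (fun S : ℝ => (S - 1) ^ (α - 2) * (c + Real.log S)) atTop (nhds 0) := by
  have h1 : Tendsto (fun S : ℝ => S - 1) atTop atTop := tendsto_atTop_add_const_right _ _ tendsto_id
  have h2 : Tendsto (fun S : ℝ => (S - 1) ^ (α - 2)) atTop (nhds 0) := by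
    have := (tendsto_rpow_neg_atTop (show 0 < 2 - α by linarith)).comp h1
    refine this.congr (fun S => ?_)
    simp
  have h3 : Tendsto (fun S : ℝ => S ^ (α - 2) / 2 ^ (α - 2) * Real.log S) atTop (nhds 0) := by
    have := ((isLittleO_log_rpow_atTop (show 0 < 2 - α by linarith)).tendsto_div_nhds_zero).div_const
      ((2 : ℝ) ^ (α - 2))
    rw [zero_div] at this
    refine this.congr' ?_
    filter_upwards [eventually_gt_atTop 0] with S hS
    rw [show α - 2 = -(2 - α) by ring, Real.rpow_neg hS.le]
    ring
  have h4 : Tendsto (fun S : ℝ => (S - 1) ^ (α - 2) * Real.log S) atTop (nhds 0) := by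
    refine squeeze_zero' ?_ ?_ h3
    · filter_upwards [eventually_gt_atTop 2] with S hS
      have := Real.log_nonneg (show 1 ≤ S by linarith)
      have := Real.rpow_nonneg (show 0 ≤ S - 1 by linarith) (α - 2)
      positivity
    · filter_upwards [eventually_gt_atTop 2] with S hS
      refine mul_le_mul_of_nonneg_right ?_ (Real.log_nonneg (show 1 ≤ S by linarith))
      rw [← Real.div_rpow (by linarith) (by norm_num)]
      exact Real.rpow_le_rpow_of_nonpos (by linarith) (by linarith) (by linarith)
  have := (h2.mul_const c).add h4
  simp only [zero_mul, add_zero] at this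
  exact this.congr (fun S => by ring)

lemma P_lim {α : ℝ} (hα0 : 0 < α) (hα2 : α < 2) : Tendsto (Pfun α) atTop (nhds 0) := by
  refine squeeze_zero_norm' ?_ (decay hα2 (1 / α))
  filter_upwards [eventually_gt_atTop 1] with S hS
  have hM := M_bound hα0 hα2 hS
  have hl := Real.log_nonneg hS.le
  have e : Pfun α S = Mfun α S * (Real.log S - 1 / α) := by unfold Pfun; ring
  rw [e, norm_mul, Real.norm_eq_abs, Real.norm_eq_abs]
  have hi : 0 < 1 / α := by positivity
  have : |Real.log S - 1 / α| ≤ 1 / α + Real.log S := by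
    rw [abs_le]; constructor <;> linarith
  gcongr

noncomputable def bd (α S : ℝ) : ℝ :=
  ∫ s in S..(S + 1), (|s - 1| ^ (α - 1) * Real.log s - |s| ^ (α - 1) * Real.log (s - 1))

lemma bd_lim {α : ℝ} (hα0 : 0 < α) (hα2 : α < 2) : Tendsto (bd α) atTop (nhds 0) := by
  have hr : |α - 1| ≤ 1 := abs_le.2 ⟨by linarith, by linarith⟩
  refine squeeze_zero_norm' ?_ (decay hα2 1)
  filter_upwards [eventually_gt_atTop 2] with S hS
  have h := intervalIntegral.norm_integral_le_of_norm_le_const (a := S) (b := S + 1)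
    (C := (S - 1) ^ (α - 2) * (1 + Real.log S))
    (f := fun s => |s - 1| ^ (α - 1) * Real.log s - |s| ^ (α - 1) * Real.log (s - 1)) ?_
  · simpa [bd] using h
  intro s hs
  rw [uIoc_of_le (by linarith)] at hs
  obtain ⟨hs1, hs2⟩ := hs
  rw [abs_of_pos (show 0 < s by linarith), abs_of_pos (show 0 < s - 1 by linarith), Real.norm_eq_abs]
  have hd := diff_bound hr (show 0 < s - 1 by linarith) (show s - 1 ≤ s by linarith)
  rw [show α - 1 - 1 = α - 2 by ring, show s - (s - 1) = 1 by ring, mul_one, abs_sub_comm] at hd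
  have hl0 : 0 ≤ Real.log (s - 1) := Real.log_nonneg (by linarith)
  have hl1 : Real.log (s - 1) ≤ Real.log S := Real.log_le_log (by linarith) (by linarith)
  have hl2 : Real.log (s - 1) ≤ Real.log s := Real.log_le_log (by linarith) (by linarith)
  have hl3 : Real.log s - Real.log (s - 1) ≤ (s - 1)⁻¹ := by
    rw [← Real.log_div (by linarith) (by linarith)]
    have := Real.log_le_sub_one_of_pos (x := s / (s - 1)) (div_pos (by linarith) (by linarith))
    have e : s / (s - 1) - 1 = (s - 1)⁻¹ := by
      have : s - 1 ≠ 0 := by linarith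
      field_simp; ring
    linarith
  have hpw : (s - 1) ^ (α - 2) ≤ (S - 1) ^ (α - 2) :=
    Real.rpow_le_rpow_of_nonpos (by linarith) (by linarith) (by linarith)
  have hp0 : 0 ≤ (s - 1) ^ (α - 2) := Real.rpow_nonneg (by linarith) _
  have hf : (s - 1) ^ (α - 1) = (s - 1) ^ (α - 2) * (s - 1) := by
    rw [← Real.rpow_add_one (by linarith)]; ring_nf
  have hf0 : 0 ≤ (s - 1) ^ (α - 1) := Real.rpow_nonneg (by linarith) _
  have e : (s - 1) ^ (α - 1) * Real.log s - s ^ (α - 1) * Real.log (s - 1) =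
      (s - 1) ^ (α - 1) * (Real.log s - Real.log (s - 1)) +
      ((s - 1) ^ (α - 1) - s ^ (α - 1)) * Real.log (s - 1) := by ring
  have b1 : |(s - 1) ^ (α - 1) * (Real.log s - Real.log (s - 1))| ≤ (s - 1) ^ (α - 2) := by
    rw [abs_of_nonneg (mul_nonneg hf0 (by linarith))]
    calc _ ≤ (s - 1) ^ (α - 1) * (s - 1)⁻¹ := by gcongr
      _ = _ := by rw [hf, mul_assoc, mul_inv_cancel₀ (by linarith), mul_one]
  have b2 : |((s - 1) ^ (α - 1) - s ^ (α - 1)) * Real.log (s - 1)| ≤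
      (s - 1) ^ (α - 2) * Real.log S := by
    rw [abs_mul, abs_of_nonneg hl0]
    gcongr
  rw [e]
  calc _ ≤ _ := abs_add_le _ _
    _ ≤ (s - 1) ^ (α - 2) * (1 + Real.log S) := by linarith
    _ ≤ _ := by
      refine mul_le_mul_of_nonneg_right hpw ?_
      linarith

lemma core {α : ℝ} (hα0 : 0 < α) (hα2 : α < 2) (S : ℝ) (hS : 1 < S) :
    ∫ s in (-S)..S, |s| ^ (α - 1) * (Real.log (s + 1) - Real.log s) =
      bd α S + Pfun α S + (∫ v in (0)..S, gfun α v) / α := by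
  rw [add_assoc, ← B_integral hα0 hα2 S (by linarith)]
  set F : ℝ → ℝ := fun s => |s - 1| ^ (α - 1) * Real.log s with hF
  have iF : ∀ a b, IntervalIntegrable F volume a b := ii3 hα0 hα2
  have i1 := ii1 hα0
  have e1 : ∫ s in (-S)..S, |s| ^ (α - 1) * (Real.log (s + 1) - Real.log s) =
      (∫ s in (-S)..S, |s| ^ (α - 1) * Real.log (s + 1)) - ∫ s in (-S)..S, |s| ^ (α - 1) * Real.log s := by
    rw [← intervalIntegral.integral_sub (ii2 hα0 hα2 _ _) (i1 _ _)]
    simp only [mul_sub]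
  have e2 : (∫ s in (-S)..S, |s| ^ (α - 1) * Real.log (s + 1)) = ∫ s in (-S + 1)..(S + 1), F s := by
    rw [← intervalIntegral.integral_comp_add_right]
    simp [hF]
  have e3 : (∫ s in (-S)..(-S + 1), F s) = ∫ s in S..(S + 1), |s| ^ (α - 1) * Real.log (s - 1) := by
    have : ∫ s in S..(S + 1), |s| ^ (α - 1) * Real.log (s - 1) = ∫ s in S..(S + 1), F (1 - s) := by
      congr 1; funext s
      simp only [hF]
      rw [show 1 - s - 1 = -s by ring, abs_neg, ← Real.log_neg_eq_log (s - 1)]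
      ring_nf
    rw [this, intervalIntegral.integral_comp_sub_left]
    congr 1 <;> ring
  have e4 : bd α S = (∫ s in S..(S + 1), F s) - ∫ s in S..(S + 1), |s| ^ (α - 1) * Real.log (s - 1) := by
    unfold bd
    rw [← intervalIntegral.integral_sub (iF _ _)]
    have := (ii4 hα0 hα2 (S - 1) S).comp_sub_right 1 enorm_ne_top
    simpa using this
  have a1 := intervalIntegral.integral_add_adjacent_intervals (iF (-S) (-S + 1)) (iF (-S + 1) (S + 1))
  have a2 := intervalIntegral.integral_add_adjacent_intervals (iF (-S) 0) (iF 0 S)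
  have a3 := intervalIntegral.integral_add_adjacent_intervals (iF (-S) S) (iF S (S + 1))
  have a4 := intervalIntegral.integral_add_adjacent_intervals (i1 (-S) 0) (i1 0 S)
  have r1 : (∫ s in (-S)..0, F s) = ∫ s in (0)..S, |s + 1| ^ (α - 1) * Real.log s := by
    have := intervalIntegral.integral_comp_neg (a := 0) (b := S) F
    rw [neg_zero] at this
    rw [← this]
    congr 1; funext s
    simp only [hF]
    rw [Real.log_neg_eq_log, ← abs_neg]
    ring_nf
  have r2 : (∫ s in (-S)..0, |s| ^ (α - 1) * Real.log s) = ∫ s in (0)..S, |s| ^ (α - 1) * Real.log s := by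
    have := intervalIntegral.integral_comp_neg (a := 0) (b := S) (fun s => |s| ^ (α - 1) * Real.log s)
    rw [neg_zero] at this
    rw [← this]
    simp
  have eB : ∫ v in (0)..S, Bfun α v * Real.log v = (∫ s in (0)..S, F s) +
      (∫ s in (0)..S, |s + 1| ^ (α - 1) * Real.log s) - 2 * ∫ s in (0)..S, |s| ^ (α - 1) * Real.log s := by
    rw [← intervalIntegral.integral_const_mul, ← intervalIntegral.integral_add (iF _ _) (ii4 hα0 hα2 _ _),
      ← intervalIntegral.integral_sub ((iF _ _).add (ii4 hα0 hα2 _ _)) ((i1 _ _).const_mul 2)]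
    congr 1; funext s
    simp only [hF, Bfun]
    ring
  rw [e1, e2, e4, eB]
  linarith

lemma main_lim {α : ℝ} (hα0 : 0 < α) (hα2 : α < 2) :
    Tendsto (fun S : ℝ => ∫ s in (-S)..S, |s| ^ (α - 1) * (Real.log (s + 1) - Real.log s)) atTop
      (nhds (1 / α * ∫ v in Ioi (0 : ℝ), gfun α v)) := by
  have h := ((bd_lim hα0 hα2).add (P_lim hα0 hα2)).add
    ((intervalIntegral_tendsto_integral_Ioi 0 (g_int hα0 hα2) tendsto_id).div_const α)
  have e : 0 + 0 + (∫ v in Ioi (0 : ℝ), gfun α v) / α = 1 / α * ∫ v in Ioi (0 : ℝ), gfun α v := by ring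
  rw [e] at h
  refine h.congr' ?_
  filter_upwards [eventually_gt_atTop 1] with S hS
  exact (core hα0 hα2 S hS).symm

lemma change_var {α x ε : ℝ} (hx : x ≠ 0) (hε : 0 < ε) :
    ∫ x' in {x' : ℝ | ε < |x' - x|}, (Real.log |x'| - Real.log |x|) / |x - x'| ^ (1 + α) =
      (∫ s in (-(|x| / ε))..(|x| / ε), |s| ^ (α - 1) * (Real.log (s + 1) - Real.log s)) * |x| ^ (-α) := by
  have hxp : 0 < |x| := abs_pos.2 hx
  set S := |x| / ε with hS
  have hSp : 0 < S := by positivity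
  set T : Set ℝ := {s | s ≠ 0 ∧ |s| < S} with hT
  have hTm : MeasurableSet T := by
    have : T = {0}ᶜ ∩ {s | |s| < S} := by ext s; simp [hT]
    rw [this]
    exact (measurableSet_singleton 0).compl.inter (measurableSet_lt measurable_norm measurable_const)
  have himg : {x' : ℝ | ε < |x' - x|} = (fun s => x + x / s) '' T := by
    ext y
    simp only [mem_setOf_eq, mem_image, hT]
    constructor
    · intro hy
      have hyx : y - x ≠ 0 := by
        intro h; rw [h, abs_zero] at hy; linarith
      refine ⟨x / (y - x), ⟨div_ne_zero hx hyx, ?_⟩, ?_⟩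
      · rw [abs_div, hS]
        exact div_lt_div_of_pos_left hxp hε hy
      · field_simp; ring
    · rintro ⟨s, ⟨hs, hsS⟩, rfl⟩
      have hsp := abs_pos.2 hs
      rw [add_sub_cancel_left, abs_div, lt_div_iff₀ hsp]
      rw [hS, lt_div_iff₀ hε] at hsS
      linarith
  rw [himg, integral_image_eq_integral_abs_deriv_smul (f' := fun s => -x / s ^ 2) hTm]
  · have hae : T =ᵐ[volume] Ioc (-S) S := by
      have h0 : ∀ᵐ s : ℝ ∂volume, s ≠ 0 := by simp [ae_iff]
      have h1 : ∀ᵐ s : ℝ ∂volume, s ≠ S := by simp [ae_iff]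
      filter_upwards [h0, h1] with s hs0 hs1
      refine propext ?_
      change (s ≠ 0 ∧ |s| < S) ↔ (-S < s ∧ s ≤ S)
      rw [abs_lt]
      constructor
      · rintro ⟨_, h2, h3⟩; exact ⟨h2, h3.le⟩
      · rintro ⟨h2, h3⟩; exact ⟨hs0, h2, lt_of_le_of_ne h3 hs1⟩
    rw [intervalIntegral.integral_of_le (by linarith), ← integral_mul_const, ← setIntegral_congr_set hae]
    refine setIntegral_congr_ae hTm ?_
    have h1 : ∀ᵐ s : ℝ ∂volume, s ≠ -1 := by simp [ae_iff]
    filter_upwards [h1] with s hs1 hsT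
    have hs0 : s ≠ 0 := hsT.1
    have hsp := abs_pos.2 hs0
    have hs1' : s + 1 ≠ 0 := fun h => hs1 (by linarith)
    have el : Real.log |x + x / s| - Real.log |x| = Real.log (s + 1) - Real.log s := by
      rw [show x + x / s = x * (s + 1) / s by field_simp, Real.log_abs, Real.log_abs,
        Real.log_div (mul_ne_zero hx hs1') hs0, Real.log_mul hx hs1']
      ring
    rw [el, show x - (x + x / s) = -(x / s) by ring, abs_neg, abs_div, abs_div, abs_neg, abs_pow,
      Real.div_rpow hxp.le hsp.le, smul_eq_mul, Real.rpow_add hxp, Real.rpow_add hsp, Real.rpow_neg hxp.le,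
      Real.rpow_sub hsp, Real.rpow_one, Real.rpow_one]
    have p1 : |x| ^ α ≠ 0 := (Real.rpow_pos_of_pos hxp _).ne'
    have p2 : |s| ^ α ≠ 0 := (Real.rpow_pos_of_pos hsp _).ne'
    field_simp
  · intro s hs
    have hs0 : s ≠ 0 := hs.1
    have := ((hasDerivAt_inv hs0).const_mul x).const_add x
    refine (this.congr_deriv ?_).hasDerivWithinAt
    field_simp
  · intro a ha b hb hab
    have ha0 : a ≠ 0 := ha.1
    have hb0 : b ≠ 0 := hb.1
    simp only [add_right_inj] at hab
    rw [div_eq_div_iff ha0 hb0] at hab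
    exact (mul_left_cancel₀ hx hab).symm

/-- For `0 < α < 2` and `x ≠ 0`, the principal value limit
`lim_{ε↓0} ∫_{|x'-x|>ε} (ln|x'| - ln|x|) / |x-x'|^{1+α} dx'` exists and equals
`γ(α,1) · |x|^{-α}`, where
`γ(α,1) = (1/α) ∫₀^∞ v⁻¹ (|v-1|^{α-1} - (v+1)^{α-1}) dv`. -/
theorem stmt1 (α x : ℝ) (hα0 : 0 < α) (hα2 : α < 2) (hx : x ≠ 0) :
    Tendsto
      (fun ε : ℝ => ∫ x' in {x' : ℝ | ε < |x' - x|},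
        (Real.log |x'| - Real.log |x|) / |x - x'| ^ (1 + α))
      (nhdsWithin 0 (Ioi 0))
      (nhds
        ((1 / α *
            ∫ v in Ioi (0 : ℝ),
              v⁻¹ * (|v - 1| ^ (α - 1) - (v + 1) ^ (α - 1))) *
          |x| ^ (-α))) := by
  have hS : Tendsto (fun ε : ℝ => |x| / ε) (nhdsWithin 0 (Ioi 0)) atTop := by
    simp only [div_eq_mul_inv]
    exact tendsto_inv_nhdsGT_zero.const_mul_atTop (abs_pos.2 hx)
  have h := ((main_lim hα0 hα2).comp hS).mul_const (|x| ^ (-α))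
  refine h.congr' ?_
  filter_upwards [self_mem_nhdsWithin] with ε hε
  exact (change_var hx hε).symm
end

section
/- Let 0 < α < 2 and p ∈ (0, α+1) with p ≠ 1. Then γ(α,p) = ∫₀¹ (u^{p−1} − 1)(1 − u^{α−p}) · ((1−u)^{−1−α} + (1+u)^{−1−α}) du, where the integral on the right converges. -/
open MeasureTheory Filter Set

noncomputable def kA (α p t : ℝ) : ℝ := (t ^ (p - 1) - 1) * (1 + t) ^ (-1 - α)
noncomputable def kB (α p t : ℝ) : ℝ := (t ^ (p - 1) - 1) * (1 - t) ^ (-1 - α)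
noncomputable def kC (α p t : ℝ) : ℝ := t ^ (α - p) * kB α p t
noncomputable def JJ (α p v : ℝ) : ℝ := v ^ (p - 2) * (|v - 1| ^ (α - p) - (v + 1) ^ (α - p))

lemma lip_rpow (q : ℝ) : ∃ C : ℝ, 0 ≤ C ∧ ∀ y : ℝ, |y| ≤ 1/2 → |(1 + y) ^ q - 1| ≤ C * |y| := by
  obtain ⟨C, hC⟩ := (isCompact_Icc (a := (-(1/2) : ℝ)) (b := 1/2)).exists_bound_of_continuousOn
    (f := fun y : ℝ => 1 * q * (1 + y) ^ (q - 1)) (by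
      intro x hx
      have : (0:ℝ) < 1 + x := by have := hx.1; linarith
      apply ContinuousAt.continuousWithinAt
      fun_prop (disch := exact Or.inl this.ne'))
  refine ⟨C, (norm_nonneg _).trans (hC 0 (by norm_num)), fun y hy => ?_⟩
  have hy' := abs_le.1 hy
  have := (convex_Icc (-(1/2) : ℝ) (1/2)).norm_image_sub_le_of_norm_hasDerivWithin_le
    (f := fun y : ℝ => (1 + y) ^ q) (f' := fun y => 1 * q * (1 + y) ^ (q - 1)) (C := C) (x := 0) (y := y)
    (fun x hx => by
      have : (0:ℝ) < 1 + x := by have := hx.1; linarith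
      exact (((hasDerivAt_id x).const_add 1).rpow_const (Or.inl this.ne')).hasDerivWithinAt)
    hC (by norm_num) ⟨hy'.1, hy'.2⟩
  simpa using this

lemma quad_rpow (q : ℝ) : ∃ C : ℝ, 0 ≤ C ∧ ∀ y : ℝ, |y| ≤ 1/2 →
    |(1 + y) ^ q - 1 - q * y| ≤ C * y ^ 2 := by
  obtain ⟨C, hC0, hC⟩ := lip_rpow (q - 1)
  refine ⟨|q| * C, by positivity, fun y hy => ?_⟩
  have := (convex_Icc (-|y|) |y|).norm_image_sub_le_of_norm_hasDerivWithin_le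
    (f := fun y : ℝ => (1 + y) ^ q - q * y) (f' := fun y => 1 * q * (1 + y) ^ (q - 1) - q * 1)
    (C := |q| * C * |y|) (x := 0) (y := y)
    (fun x hx => by
      have : (0:ℝ) < 1 + x := by have := hx.1; linarith
      exact ((((hasDerivAt_id x).const_add 1).rpow_const (Or.inl this.ne')).sub
        ((hasDerivAt_id x).const_mul q)).hasDerivWithinAt)
    (fun x hx => by
      have h1 : |x| ≤ |y| := abs_le.2 hx
      have h2 := hC x (h1.trans hy)
      rw [show 1 * q * (1 + x) ^ (q - 1) - q * 1 = q * ((1 + x) ^ (q - 1) - 1) by ring,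
        Real.norm_eq_abs, abs_mul, mul_assoc]
      gcongr
      exact h2.trans (by gcongr)) (by simp) ⟨neg_abs_le y, le_abs_self y⟩
  simp only [add_zero, Real.one_rpow, mul_zero, sub_zero, Real.norm_eq_abs] at this
  rw [show (1 + y) ^ q - 1 - q * y = (1 + y) ^ q - q * y - 1 by ring]
  refine this.trans (le_of_eq ?_)
  rw [mul_assoc, abs_mul_abs_self]; ring

/-! pointwise identities -/
lemma kA_id (α p v : ℝ) (h0 : 0 < v) (h1 : v < 1) :
    kA α p (v / (1 - v)) * (1 / (1 - v) ^ 2) = v ^ (p - 1) * (1 - v) ^ (α - p) - (1 - v) ^ (α - 1) := by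
  have hX : 0 < 1 - v := by linarith
  unfold kA
  rw [show 1 + v / (1 - v) = (1 - v)⁻¹ by field_simp; ring, Real.inv_rpow hX.le, ← Real.rpow_neg hX.le,
    Real.div_rpow h0.le hX.le, show α - p = -(-1 - α) - 2 - (p - 1) by ring, Real.rpow_sub hX _ (p - 1),
    Real.rpow_sub hX _ 2, show α - 1 = -(-1 - α) - 2 by ring, Real.rpow_sub hX _ 2]
  simp only [Real.rpow_two]
  have := (Real.rpow_pos_of_pos hX (p - 1)).ne'
  generalize (1 - v) ^ (p - 1) = E at *
  field_simp

lemma kB_id (α p v : ℝ) (h0 : 0 < v) :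
    kB α p (v / (1 + v)) * (1 / (1 + v) ^ 2) = v ^ (p - 1) * (1 + v) ^ (α - p) - (1 + v) ^ (α - 1) := by
  have hX : 0 < 1 + v := by linarith
  unfold kB
  rw [show 1 - v / (1 + v) = (1 + v)⁻¹ by field_simp; ring, Real.inv_rpow hX.le, ← Real.rpow_neg hX.le,
    Real.div_rpow h0.le hX.le, show α - p = -(-1 - α) - 2 - (p - 1) by ring, Real.rpow_sub hX _ (p - 1),
    Real.rpow_sub hX _ 2, show α - 1 = -(-1 - α) - 2 by ring, Real.rpow_sub hX _ 2]
  simp only [Real.rpow_two]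
  have := (Real.rpow_pos_of_pos hX (p - 1)).ne'
  generalize (1 + v) ^ (p - 1) = E at *
  field_simp

lemma kC_id (α p v : ℝ) (h1 : 1 < v) :
    kC α p ((v - 1) / v) * (1 / v ^ 2) = (v - 1) ^ (α - 1) - v ^ (p - 1) * (v - 1) ^ (α - p) := by
  have hX : 0 < v - 1 := by linarith
  have h0 : 0 < v := by linarith
  unfold kC kB
  rw [show 1 - (v - 1) / v = v⁻¹ by field_simp; ring, Real.inv_rpow h0.le, ← Real.rpow_neg h0.le,
    Real.div_rpow hX.le h0.le, Real.div_rpow hX.le h0.le, 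
    show -(-1 - α) = (α - p) + (p - 1) + 2 by ring, Real.rpow_add h0, Real.rpow_add h0, 
    show α - 1 = (α - p) + (p - 1) by ring, Real.rpow_add hX]
  simp only [Real.rpow_two]
  have := (Real.rpow_pos_of_pos h0 (p - 1)).ne'
  have := (Real.rpow_pos_of_pos h0 (α - p)).ne'
  field_simp
  
lemma fold_id (α p u : ℝ) (h0 : 0 < u) :
    |-(u ^ 2)⁻¹| • kA α p u⁻¹ = u ^ (α - p) * (1 - u ^ (p - 1)) * (1 + u) ^ (-1 - α) := by
  have hX : 0 < 1 + u := by linarith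
  unfold kA
  rw [abs_neg, abs_of_pos (by positivity), smul_eq_mul, show 1 + u⁻¹ = (1 + u) / u by field_simp; ring,
    Real.div_rpow hX.le h0.le, Real.inv_rpow h0.le,
    show -1 - α = -((α - p) + (p - 1) + 2) by ring, Real.rpow_neg h0.le,  Real.rpow_add h0, Real.rpow_add h0]
  simp only [Real.rpow_two]
  have := (Real.rpow_pos_of_pos h0 (p - 1)).ne'
  have := (Real.rpow_pos_of_pos h0 (α - p)).ne'
  field_simp

/-! FTC lemmas -/
lemma ftc_Ioo (W f : ℝ → ℝ) (a b l r ε : ℝ) (hab : a < b) (hε : ε ≠ 0)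
    (hd : ∀ x ∈ Ioo a b, HasDerivAt W (f x) x) (hf : ∀ x ∈ Ioo a b, 0 ≤ ε * f x)
    (hl : Tendsto W (nhdsWithin a (Ioi a)) (nhds l)) (hr : Tendsto W (nhdsWithin b (Iio b)) (nhds r)) :
    IntegrableOn f (Ioo a b) ∧ ∫ x in Ioo a b, f x = r - l := by
  have hi : IntegrableOn (fun x => ε * f x) (Ioc a b) := by
    have hc : ContinuousOn (extendFrom (Ioo a b) W) (Icc a b) :=
      continuousOn_Icc_extendFrom_Ioo (fun x hx => (hd x hx).continuousAt.continuousWithinAt) hl hr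
    refine intervalIntegral.integrableOn_deriv_of_nonneg (g := fun x => ε * extendFrom (Ioo a b) W x)
      (continuousOn_const.mul hc) (fun x hx => ?_) hf
    refine HasDerivAt.const_mul ε ((hd x hx).congr_of_eventuallyEq ?_)
    filter_upwards [Ioo_mem_nhds hx.1 hx.2] with y hy
    exact extendFrom_extends (f := W) (A := Ioo a b) (fun x hx => (hd x hx).continuousAt.continuousWithinAt) y hy
  have hi' : IntegrableOn f (Ioc a b) := by
    have := hi.const_mul ε⁻¹
    simp only [inv_mul_cancel_left₀ hε] at this
    exact this
  refine ⟨hi'.mono_set Ioo_subset_Ioc_self, ?_⟩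
  rw [← integral_Ioc_eq_integral_Ioo, ← intervalIntegral.integral_of_le hab.le]
  exact intervalIntegral.integral_eq_sub_of_hasDerivAt_of_tendsto hab hd
    ((intervalIntegrable_iff_integrableOn_Ioc_of_le hab.le).2 hi') hl hr

lemma ftc_Ioi (W f : ℝ → ℝ) (a r ε : ℝ) (hε : ε ≠ 0)
    (hd : ∀ x ∈ Ioi a, HasDerivAt W (f x) x) (hf : ∀ x ∈ Ioi a, 0 ≤ ε * f x)
    (hl : ContinuousWithinAt W (Ici a) a) (hr : Tendsto W atTop (nhds r)) :
    IntegrableOn f (Ioi a) ∧ ∫ x in Ioi a, f x = r - W a := by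
  have hi : IntegrableOn (fun x => ε * f x) (Ioi a) := 
    integrableOn_Ioi_deriv_of_nonneg (g := fun x => ε * W x) (continuousWithinAt_const.mul hl)
      (fun x hx => (hd x hx).const_mul ε) hf (hr.const_mul ε)
  have hi' : IntegrableOn f (Ioi a) := by
    have := hi.const_mul ε⁻¹
    simp only [inv_mul_cancel_left₀ hε] at this
    exact this
  exact ⟨hi', integral_Ioi_of_hasDerivAt_of_tendsto hl hd hi' hr⟩

lemma sub_rpow_lip (q : ℝ) : ∃ C : ℝ, 0 ≤ C ∧ ∀ u : ℝ, 1/2 ≤ u → u ≤ 1 → |u ^ q - 1| ≤ C * (1 - u) := by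
  obtain ⟨C, hC0, hC⟩ := lip_rpow q
  refine ⟨C, hC0, fun u h1 h2 => ?_⟩
  have := hC (u - 1) (by rw [abs_le]; constructor <;> linarith)
  rw [add_sub_cancel, abs_sub_comm u 1, abs_of_nonneg (by linarith : 0 ≤ 1 - u)] at this
  exact this

lemma kB_bound (α p : ℝ) : ∃ C : ℝ, 0 ≤ C ∧ ∀ u : ℝ, 1/2 ≤ u → u < 1 → |kB α p u| ≤ C * (1 - u) ^ (-α) := by
  obtain ⟨C, hC0, hC⟩ := sub_rpow_lip (p - 1)
  refine ⟨C, hC0, fun u h1 h2 => ?_⟩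
  have hX : 0 < 1 - u := by linarith
  unfold kB
  rw [abs_mul, abs_of_pos (Real.rpow_pos_of_pos hX _), show -α = 1 + (-1 - α) by ring,
    Real.rpow_add hX, Real.rpow_one, ← mul_assoc]
  exact mul_le_mul_of_nonneg_right (hC u h1 h2.le) (Real.rpow_pos_of_pos hX _).le

lemma kA_meas (α p : ℝ) : Measurable (kA α p) := by unfold kA; fun_prop
lemma kB_meas (α p : ℝ) : Measurable (kB α p) := by unfold kB; fun_prop
lemma kC_meas (α p : ℝ) : Measurable (kC α p) := by unfold kC kB; fun_prop

lemma kA_cont (α p t : ℝ) (h : 0 < t) : ContinuousAt (kA α p) t := by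
  unfold kA
  have : 1 + t ≠ 0 := by linarith
  fun_prop (disch := first | exact Or.inl h.ne' | exact Or.inl this)
lemma kB_cont (α p t : ℝ) (h : 0 < t) (h1 : t < 1) : ContinuousAt (kB α p) t := by
  unfold kB
  have : 1 - t ≠ 0 := by linarith
  fun_prop (disch := first | exact Or.inl h.ne' | exact Or.inl this)
lemma kC_cont (α p t : ℝ) (h : 0 < t) (h1 : t < 1) : ContinuousAt (kC α p) t := by
  unfold kC kB
  have : 1 - t ≠ 0 := by linarith
  fun_prop (disch := first | exact Or.inl h.ne' | exact Or.inl this)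

lemma ii_rpow_sub (q r x : ℝ) (hq : -1 < q) (hr : -1 < r) (g : ℝ → ℝ) (hg : ContinuousOn g (uIcc 0 x)) :
    IntervalIntegrable (fun t => (t ^ q - t ^ r) * g t) volume 0 x :=
  ((intervalIntegral.intervalIntegrable_rpow' hq).sub
    (intervalIntegral.intervalIntegrable_rpow' hr)).mul_continuousOn hg

lemma g_plus (α x : ℝ) (hx : 0 ≤ x) : ContinuousOn (fun t : ℝ => (1 + t) ^ (-1 - α)) (uIcc 0 x) := by
  rw [uIcc_of_le hx]
  intro t ht
  have : 1 + t ≠ 0 := by have := ht.1; linarith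
  apply ContinuousAt.continuousWithinAt
  fun_prop (disch := exact Or.inl this)
lemma g_minus (α x : ℝ) (hx : 0 ≤ x) (hx1 : x < 1) :
    ContinuousOn (fun t : ℝ => (1 - t) ^ (-1 - α)) (uIcc 0 x) := by
  rw [uIcc_of_le hx]
  intro t ht
  have : 1 - t ≠ 0 := by have := ht.2; linarith
  apply ContinuousAt.continuousWithinAt
  fun_prop (disch := exact Or.inl this)

lemma kA_ii (α p x : ℝ) (hp : 0 < p) (hx : 0 ≤ x) : IntervalIntegrable (kA α p) volume 0 x := by
  have := ii_rpow_sub (p - 1) 0 x (by linarith) (by norm_num) _ (g_plus α x hx)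
  simp only [Real.rpow_zero] at this
  exact this
lemma kB_ii (α p x : ℝ) (hp : 0 < p) (hx : 0 ≤ x) (hx1 : x < 1) : IntervalIntegrable (kB α p) volume 0 x := by
  have := ii_rpow_sub (p - 1) 0 x (by linarith) (by norm_num) _ (g_minus α x hx hx1)
  simp only [Real.rpow_zero] at this
  exact this

lemma expand (α p u : ℝ) (h : 0 < u) : u ^ (α - p) * (u ^ (p - 1) - 1) = u ^ (α - 1) - u ^ (α - p) := by
  rw [mul_sub, ← Real.rpow_add h, mul_one]; congr 2; ring

lemma kC_ii (α p x : ℝ) (hα : 0 < α) (hp1 : p < α + 1) (hx : 0 ≤ x) (hx1 : x < 1) :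
    IntervalIntegrable (kC α p) volume 0 x := by
  have := ii_rpow_sub (α - 1) (α - p) x (by linarith) (by linarith) _ (g_minus α x hx hx1)
  refine this.congr ?_
  rw [uIoc_of_le hx]
  intro t ht
  simp only [kC, kB]
  rw [← mul_assoc, expand α p t ht.1]

/-- the folded part of kA -/
lemma kA_Ioi (α p : ℝ) (hα : 0 < α) (hp : 0 < p) (hp1 : p < α + 1) :
    IntegrableOn (kA α p) (Ioi 0) ∧
    IntegrableOn (fun u : ℝ => (u ^ (p - 1) - 1) * (1 - u ^ (α - p)) * (1 + u) ^ (-1 - α)) (Ioo 0 1) ∧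
    ∫ t in Ioi 0, kA α p t =
      ∫ u in Ioo (0:ℝ) 1, (u ^ (p - 1) - 1) * (1 - u ^ (α - p)) * (1 + u) ^ (-1 - α) := by
  have him : (fun u : ℝ => u⁻¹) '' Ioo 0 1 = Ioi 1 := by
    ext x
    simp only [mem_image, mem_Ioo, mem_Ioi]
    constructor
    · rintro ⟨u, ⟨h0, h1⟩, rfl⟩
      exact (one_lt_inv₀ h0).2 h1
    · intro hx
      exact ⟨x⁻¹, ⟨by positivity, inv_lt_one_of_one_lt₀ hx⟩, inv_inv x⟩
  have hd : ∀ x ∈ Ioo (0:ℝ) 1, HasDerivWithinAt (fun u : ℝ => u⁻¹) (-(x ^ 2)⁻¹) (Ioo 0 1) x :=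
    fun x hx => (hasDerivAt_inv hx.1.ne').hasDerivWithinAt
  have hinj : InjOn (fun u : ℝ => u⁻¹) (Ioo 0 1) := fun x _ y _ h => inv_injective h
  have e : EqOn (fun u => |-(u ^ 2)⁻¹| • kA α p u⁻¹)
      (fun u => (u ^ (α - p) - u ^ (α - 1)) * (1 + u) ^ (-1 - α)) (Ioo 0 1) := fun u hu => by
    simp only []
    rw [fold_id α p u hu.1]
    have := expand α p u hu.1
    congr 1; linarith
  have hi1 : IntegrableOn (fun u : ℝ => (u ^ (α - p) - u ^ (α - 1)) * (1 + u) ^ (-1 - α)) (Ioo 0 1) :=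
    ((intervalIntegrable_iff_integrableOn_Ioo_of_le zero_le_one).1
      (ii_rpow_sub (α - p) (α - 1) 1 (by linarith) (by linarith) _ (g_plus α 1 zero_le_one)))
  have hA1 : IntegrableOn (kA α p) (Ioi 1) := by
    rw [← him, integrableOn_image_iff_integrableOn_abs_deriv_smul measurableSet_Ioo hd hinj]
    exact hi1.congr_fun e.symm measurableSet_Ioo
  have hA0 : IntegrableOn (kA α p) (Ioc 0 1) :=
    (intervalIntegrable_iff_integrableOn_Ioc_of_le zero_le_one).1 (kA_ii α p 1 hp zero_le_one)
  have hA0' := hA0.mono_set Ioo_subset_Ioc_self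
  have e2 : EqOn (fun u : ℝ => kA α p u + (u ^ (α - p) - u ^ (α - 1)) * (1 + u) ^ (-1 - α))
    (fun u : ℝ => (u ^ (p - 1) - 1) * (1 - u ^ (α - p)) * (1 + u) ^ (-1 - α)) (Ioo 0 1) := by
    intro u hu
    simp only [kA]
    have := expand α p u hu.1
    rw [← add_mul]; congr 1; linarith
  refine ⟨?_, (hA0'.add hi1).congr_fun e2 measurableSet_Ioo, ?_⟩
  · rw [← Ioc_union_Ioi_eq_Ioi zero_le_one]; exact hA0.union hA1
  · rw [← setIntegral_congr_fun measurableSet_Ioo e2, integral_add hA0' hi1,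
      ← Ioc_union_Ioi_eq_Ioi zero_le_one, setIntegral_union (Ioc_disjoint_Ioi le_rfl) measurableSet_Ioi hA0 hA1,
      integral_Ioc_eq_integral_Ioo]
    congr 1
    rw [← him, integral_image_eq_integral_abs_deriv_smul measurableSet_Ioo hd hinj]
    exact setIntegral_congr_fun measurableSet_Ioo e

lemma kD_int (α p : ℝ) (hα : 0 < α) (hα2 : α < 2) (hp : 0 < p) (hp1 : p < α + 1) :
    IntegrableOn (fun u => kB α p u - kC α p u) (Ioc 0 1) := by
  have h1 : IntegrableOn (fun u => kB α p u - kC α p u) (Ioc 0 (1/2)) :=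
    (intervalIntegrable_iff_integrableOn_Ioc_of_le (by norm_num)).1 
      ((kB_ii α p (1/2) hp (by norm_num) (by norm_num)).sub (kC_ii α p (1/2) hα hp1 (by norm_num) (by norm_num)))
  obtain ⟨C, hC0, hC⟩ := kB_bound α p
  obtain ⟨D, hD0, hD⟩ := sub_rpow_lip (α - p)
  have h2 : IntegrableOn (fun u => kB α p u - kC α p u) (Ioo (1/2) 1) := by
    have hg : IntegrableOn (fun u : ℝ => (C * D) * (1 - u) ^ (1 - α)) (Ioo (1/2) 1) := by
      have := (intervalIntegral.intervalIntegrable_rpow' (r := 1 - α) (a := 1 - 1/2) (b := 1 - 1) (by linarith)).comp_sub_left 1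
      have := (this.const_mul (C * D))
      simp only [sub_sub_cancel] at this
      exact (intervalIntegrable_iff_integrableOn_Ioo_of_le (by norm_num)).1 this
    refine hg.mono' (((kB_meas α p).sub (kC_meas α p)).aestronglyMeasurable) ?_
    refine (ae_restrict_mem measurableSet_Ioo).mono fun u hu => ?_
    have hX : 0 < 1 - u := by linarith [hu.2]
    unfold kC
    rw [show kB α p u - u ^ (α - p) * kB α p u = kB α p u * (1 - u ^ (α - p)) by ring, Real.norm_eq_abs, abs_mul,
      abs_sub_comm 1, show 1 - α = -α + 1 by ring, Real.rpow_add hX, Real.rpow_one]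
    calc _ ≤ (C * (1 - u) ^ (-α)) * (D * (1 - u)) :=
          mul_le_mul (hC u hu.1.le hu.2) (hD u hu.1.le hu.2.le) (abs_nonneg _) (by positivity)
      _ = _ := by ring
  have h2' : IntegrableOn (fun u => kB α p u - kC α p u) (Ioc (1/2) 1) := by
    rwa [integrableOn_Ioc_iff_integrableOn_Ioo]
  have := h1.union h2'
  rwa [Ioc_union_Ioc_eq_Ioc (by norm_num) (by norm_num)] at this

lemma prim_zero (f : ℝ → ℝ) (hf : IntervalIntegrable f volume 0 (1/2)) :
    Tendsto (fun x => ∫ t in (0:ℝ)..x, f t) (nhdsWithin 0 (Ici 0)) (nhds 0) := by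
  have h := intervalIntegral.continuousOn_primitive_interval' (a := 0) hf (by simp)
  have h0 := h 0 (by simp)
  rw [ContinuousWithinAt, intervalIntegral.integral_same] at h0
  refine h0.mono_left ?_
  rw [uIcc_of_le (by norm_num)]
  exact (nhdsWithin_Icc_eq_nhdsGE (by norm_num : (0:ℝ) < 1/2)).ge

noncomputable def PA (α p x : ℝ) : ℝ := ∫ t in (0:ℝ)..x, kA α p t
noncomputable def PB (α p x : ℝ) : ℝ := ∫ t in (0:ℝ)..x, kB α p t
noncomputable def PC (α p x : ℝ) : ℝ := ∫ t in (0:ℝ)..x, kC α p t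

lemma PA_deriv (α p x : ℝ) (hp : 0 < p) (hx : 0 < x) : HasDerivAt (PA α p) (kA α p x) x :=
  intervalIntegral.integral_hasDerivAt_right (kA_ii α p x hp hx.le)
    (kA_meas α p).stronglyMeasurable.stronglyMeasurableAtFilter (kA_cont α p x hx)
lemma PB_deriv (α p x : ℝ) (hp : 0 < p) (hx : 0 < x) (hx1 : x < 1) : HasDerivAt (PB α p) (kB α p x) x :=
  intervalIntegral.integral_hasDerivAt_right (kB_ii α p x hp hx.le hx1)
    (kB_meas α p).stronglyMeasurable.stronglyMeasurableAtFilter (kB_cont α p x hx hx1)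
lemma PC_deriv (α p x : ℝ) (hα : 0 < α) (hp1 : p < α + 1) (hx : 0 < x) (hx1 : x < 1) :
    HasDerivAt (PC α p) (kC α p x) x :=
  intervalIntegral.integral_hasDerivAt_right (kC_ii α p x hα hp1 hx.le hx1)
    (kC_meas α p).stronglyMeasurable.stronglyMeasurableAtFilter (kC_cont α p x hx hx1)

noncomputable def W1 (α p v : ℝ) : ℝ :=
  (v ^ (p - 1) * ((1 - v) ^ (α - p + 1) - (1 + v) ^ (α - p + 1)) - (1 - v) ^ α + (1 + v) ^ α) +
    α * (PA α p (v / (1 - v)) + PB α p (v / (1 + v)))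
noncomputable def W2 (α p v : ℝ) : ℝ :=
  (-(v ^ (p - 1) * ((v - 1) ^ (α - p + 1) + (1 + v) ^ (α - p + 1))) + (v - 1) ^ α + (1 + v) ^ α) +
    α * (PB α p (v / (1 + v)) - PC α p ((v - 1) / v))

lemma W1_deriv (α p v : ℝ) (hp : 0 < p) (h0 : 0 < v) (h1 : v < 1) :
    HasDerivAt (W1 α p) ((p - 1) * JJ α p v) v := by
  have hX : 0 < 1 - v := by linarith
  have hY : 0 < 1 + v := by linarith
  have dX : HasDerivAt (fun v : ℝ => 1 - v) (-1) v := by simpa using (hasDerivAt_id v).const_sub 1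
  have dY : HasDerivAt (fun v : ℝ => 1 + v) 1 v := by simpa using (hasDerivAt_id v).const_add 1
  have dA : HasDerivAt (fun v : ℝ => v / (1 - v)) (1 / (1 - v) ^ 2) v := by
    refine HasDerivAt.congr_deriv ((hasDerivAt_id v).div dX hX.ne') ?_
    simp
  have dB : HasDerivAt (fun v : ℝ => v / (1 + v)) (1 / (1 + v) ^ 2) v := by
    refine HasDerivAt.congr_deriv ((hasDerivAt_id v).div dY hY.ne') ?_
    simp
  have hA := (PA_deriv α p (v / (1 - v)) hp (by positivity)).comp v dA
  have hB := (PB_deriv α p (v / (1 + v)) hp (by positivity) (by rw [div_lt_one hY]; linarith)).comp v dB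
  rw [kA_id α p v h0 h1] at hA
  rw [kB_id α p v h0] at hB
  have key := ((((hasDerivAt_id v).rpow_const (p := p - 1) (Or.inl h0.ne')).mul
    ((dX.rpow_const (p := α - p + 1) (Or.inl hX.ne')).sub (dY.rpow_const (p := α - p + 1) (Or.inl hY.ne')))).sub
    (dX.rpow_const (p := α) (Or.inl hX.ne'))).add (dY.rpow_const (p := α) (Or.inl hY.ne'))
  have key2 := key.add ((hA.add hB).const_mul α)
  refine HasDerivAt.congr_deriv (f := W1 α p) key2 ?_
  unfold JJ
  rw [abs_sub_comm, abs_of_pos hX]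
  simp only [id, Pi.sub_apply]
  rw [show α - p + 1 - 1 = α - p by ring, Real.rpow_add_one hX.ne', Real.rpow_add_one hY.ne',
    show v ^ (p - 1) = v ^ (p - 2) * v by rw [← Real.rpow_add_one h0.ne']; congr 1; ring,
    show p - 1 - 1 = p - 2 by ring, add_comm v 1]
  ring

lemma W2_deriv (α p v : ℝ) (hα : 0 < α) (hp : 0 < p) (hp1 : p < α + 1) (h1 : 1 < v) :
    HasDerivAt (W2 α p) ((p - 1) * JJ α p v) v := by
  have h0 : 0 < v := by linarith
  have hX : 0 < v - 1 := by linarith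
  have hY : 0 < 1 + v := by linarith
  have dX : HasDerivAt (fun v : ℝ => v - 1) 1 v := by simpa using (hasDerivAt_id v).sub_const 1
  have dY : HasDerivAt (fun v : ℝ => 1 + v) 1 v := by simpa using (hasDerivAt_id v).const_add 1
  have dA : HasDerivAt (fun v : ℝ => (v - 1) / v) (1 / v ^ 2) v := by
    refine HasDerivAt.congr_deriv (dX.div (hasDerivAt_id v) h0.ne') ?_
    simp
  have dB : HasDerivAt (fun v : ℝ => v / (1 + v)) (1 / (1 + v) ^ 2) v := by
    refine HasDerivAt.congr_deriv ((hasDerivAt_id v).div dY hY.ne') ?_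
    simp
  have hA := HasDerivAt.comp (h := fun v : ℝ => (v - 1) / v) v
    (PC_deriv α p ((v - 1) / v) hα hp1 (by positivity) (by rw [div_lt_one h0]; linarith)) dA
  have hB := (PB_deriv α p (v / (1 + v)) hp (by positivity) (by rw [div_lt_one hY]; linarith)).comp v dB
  rw [kC_id α p v h1] at hA
  rw [kB_id α p v h0] at hB
  have key := ((((hasDerivAt_id v).rpow_const (p := p - 1) (Or.inl h0.ne')).mul
    ((dX.rpow_const (p := α - p + 1) (Or.inl hX.ne')).add (dY.rpow_const (p := α - p + 1) (Or.inl hY.ne')))).neg.add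
    (dX.rpow_const (p := α) (Or.inl hX.ne'))).add (dY.rpow_const (p := α) (Or.inl hY.ne'))
  have key2 := key.add ((hB.sub hA).const_mul α)
  refine HasDerivAt.congr_deriv (f := W2 α p) key2 ?_
  unfold JJ
  rw [abs_of_pos hX]
  simp only [id, Pi.add_apply]
  rw [show α - p + 1 - 1 = α - p by ring, Real.rpow_add_one hX.ne', Real.rpow_add_one hY.ne',
    show v ^ (p - 1) = v ^ (p - 2) * v by rw [← Real.rpow_add_one h0.ne']; congr 1; ring,
    show p - 1 - 1 = p - 2 by ring, add_comm v 1]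
  ring

lemma PB_half (α p : ℝ) (hp : 0 < p) : ContinuousAt (fun v : ℝ => PB α p (v / (1 + v))) 1 := by
  have h1 : ContinuousAt (fun v : ℝ => v / (1 + v)) 1 := by
    fun_prop (disch := norm_num)
  have h2 : ContinuousAt (PB α p) ((1:ℝ) / (1 + 1)) :=
    (PB_deriv α p _ hp (by norm_num) (by norm_num)).continuousAt
  exact ContinuousAt.comp (f := fun v : ℝ => v / (1 + v)) h2 h1

lemma W1_zero (α p : ℝ) (hα : 0 < α) (hp : 0 < p) :
    Tendsto (W1 α p) (nhdsWithin 0 (Ioi 0)) (nhds 0) := by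
  have hA : Tendsto (fun v => PA α p (v / (1 - v))) (nhdsWithin 0 (Ioi 0)) (nhds 0) := by
    refine (prim_zero (kA α p) (kA_ii α p _ hp (by norm_num))).comp ?_
    refine tendsto_nhdsWithin_iff.2 ⟨?_, ?_⟩
    · have : ContinuousAt (fun v : ℝ => v / (1 - v)) 0 := by fun_prop (disch := norm_num)
      simpa [ContinuousAt] using this.tendsto.mono_left nhdsWithin_le_nhds
    · filter_upwards [Ioo_mem_nhdsGT (zero_lt_one (α := ℝ))] with v hv
      exact div_nonneg hv.1.le (by linarith [hv.2])
  have hB : Tendsto (fun v => PB α p (v / (1 + v))) (nhdsWithin 0 (Ioi 0)) (nhds 0) := by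
    refine (prim_zero (kB α p) (kB_ii α p _ hp (by norm_num) (by norm_num))).comp ?_
    refine tendsto_nhdsWithin_iff.2 ⟨?_, ?_⟩
    · have : ContinuousAt (fun v : ℝ => v / (1 + v)) 0 := by fun_prop (disch := norm_num)
      simpa [ContinuousAt] using this.tendsto.mono_left nhdsWithin_le_nhds
    · filter_upwards [Ioo_mem_nhdsGT (zero_lt_one (α := ℝ))] with v hv
      exact div_nonneg hv.1.le (by linarith [hv.1])
  have h1 : Tendsto (fun v : ℝ => v ^ (p - 1) * ((1 - v) ^ (α - p + 1) - (1 + v) ^ (α - p + 1)))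
      (nhdsWithin 0 (Ioi 0)) (nhds 0) := by
    obtain ⟨C, hC0, hC⟩ := lip_rpow (α - p + 1)
    refine squeeze_zero_norm' (a := fun v : ℝ => 2 * C * v ^ p) ?_ ?_
    · filter_upwards [Ioo_mem_nhdsGT (by norm_num : (0:ℝ) < 1/2)] with v hv
      have a1 := hC v (by rw [abs_of_pos hv.1]; exact hv.2.le)
      have a2 := hC (-v) (by rw [abs_neg, abs_of_pos hv.1]; exact hv.2.le)
      rw [abs_neg] at a2
      rw [abs_of_pos hv.1] at a1 a2
      rw [norm_mul, Real.norm_of_nonneg (Real.rpow_nonneg hv.1.le _), Real.norm_eq_abs,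
        show v ^ p = v ^ (p - 1) * v by rw [← Real.rpow_add_one hv.1.ne']; congr 1; ring]
      have a3 : |(1 - v) ^ (α - p + 1) - (1 + v) ^ (α - p + 1)| ≤ 2 * C * v := by
        rw [← sub_eq_add_neg] at a2
        rw [abs_le] at *
        constructor <;> linarith
      calc _ ≤ v ^ (p - 1) * (2 * C * v) := mul_le_mul_of_nonneg_left a3 (Real.rpow_nonneg hv.1.le _)
        _ = _ := by ring
    · have : ContinuousAt (fun v : ℝ => 2 * C * v ^ p) 0 := by fun_prop (disch := exact Or.inr hp.le)
      simpa [ContinuousAt, Real.zero_rpow hp.ne'] using this.tendsto.mono_left nhdsWithin_le_nhds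
  have h2 : Tendsto (fun v : ℝ => (1 - v) ^ α) (nhdsWithin 0 (Ioi 0)) (nhds 1) := by
    have : ContinuousAt (fun v : ℝ => (1 - v) ^ α) 0 := by fun_prop (disch := exact Or.inr hα.le)
    simpa [ContinuousAt] using this.tendsto.mono_left nhdsWithin_le_nhds
  have h3 : Tendsto (fun v : ℝ => (1 + v) ^ α) (nhdsWithin 0 (Ioi 0)) (nhds 1) := by
    have : ContinuousAt (fun v : ℝ => (1 + v) ^ α) 0 := by fun_prop (disch := exact Or.inr hα.le)
    simpa [ContinuousAt] using this.tendsto.mono_left nhdsWithin_le_nhds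
  have := ((h1.sub h2).add h3).add ((hA.add hB).const_mul α)
  simp only [zero_sub, neg_add_cancel, add_zero, mul_zero] at this
  exact this

lemma W1_one (α p : ℝ) (hα : 0 < α) (hp : 0 < p) (hp1 : p < α + 1) :
    Tendsto (W1 α p) (nhdsWithin 1 (Iio 1)) (nhds (-((2:ℝ) ^ (α - p + 1)) + 2 ^ α +
      α * ((∫ t in Ioi 0, kA α p t) + PB α p (1/2)))) := by
  have hA : Tendsto (fun v => PA α p (v / (1 - v))) (nhdsWithin 1 (Iio 1)) (nhds (∫ t in Ioi 0, kA α p t)) := by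
    refine intervalIntegral_tendsto_integral_Ioi 0 (kA_Ioi α p hα hp hp1).1 ?_
    have h1 : Tendsto (fun v : ℝ => v) (nhdsWithin 1 (Iio 1)) (nhds 1) := nhdsWithin_le_nhds
    have h2 : Tendsto (fun v : ℝ => (1 - v)⁻¹) (nhdsWithin 1 (Iio 1)) atTop := by
      refine tendsto_inv_nhdsGT_zero.comp (tendsto_nhdsWithin_iff.2 ⟨?_, ?_⟩)
      · simpa using h1.const_sub 1
      · filter_upwards [self_mem_nhdsWithin] with v hv
        simpa using hv
    exact h1.pos_mul_atTop one_pos h2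
  have hB := (PB_half α p hp).tendsto.mono_left (nhdsWithin_le_nhds (s := Iio 1))
  have hq : 0 ≤ α - p + 1 := by linarith
  have hc : ContinuousAt (fun v : ℝ => 
      v ^ (p - 1) * ((1 - v) ^ (α - p + 1) - (1 + v) ^ (α - p + 1)) - (1 - v) ^ α + (1 + v) ^ α) 1 := by
    fun_prop (disch := first | exact Or.inr hq | exact Or.inr hα.le | exact Or.inl one_ne_zero)
  have hc' := hc.tendsto.mono_left (nhdsWithin_le_nhds (s := Iio 1))
  have := hc'.add ((hA.add hB).const_mul α)
  have e : -((2:ℝ) ^ (α - p + 1)) + 2 ^ α + α * ((∫ t in Ioi 0, kA α p t) + PB α p (1/2)) =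
      (1:ℝ) ^ (p - 1) * ((1 - 1) ^ (α - p + 1) - (1 + 1) ^ (α - p + 1)) - (1 - 1) ^ α + (1 + 1) ^ α +
      α * ((∫ (t : ℝ) in Ioi 0, kA α p t) + PB α p (1 / (1 + 1))) := by
    norm_num [Real.zero_rpow hα.ne', Real.zero_rpow (by linarith : α - p + 1 ≠ 0)]
  rw [e]
  exact this

lemma W2_one (α p : ℝ) (hα : 0 < α) (hp1 : p < α + 1) :
    W2 α p 1 = -((2:ℝ) ^ (α - p + 1)) + 2 ^ α + α * PB α p (1/2) := by
  unfold W2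
  norm_num [Real.zero_rpow hα.ne', Real.zero_rpow (by linarith : α - p + 1 ≠ 0), PC]

lemma W2_cont (α p : ℝ) (hα : 0 < α) (hp : 0 < p) (hp1 : p < α + 1) :
    ContinuousWithinAt (W2 α p) (Ici 1) 1 := by
  have hB := (PB_half α p hp).continuousWithinAt (s := Ici 1)
  have hq : 0 ≤ α - p + 1 := by linarith
  have hc : ContinuousAt (fun v : ℝ => 
      -(v ^ (p - 1) * ((v - 1) ^ (α - p + 1) + (1 + v) ^ (α - p + 1))) + (v - 1) ^ α + (1 + v) ^ α) 1 := by
    fun_prop (disch := first | exact Or.inr hq | exact Or.inr hα.le | exact Or.inl one_ne_zero)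
  have hC : ContinuousWithinAt (fun v => PC α p ((v - 1) / v)) (Ici 1) 1 := by
    have : Tendsto (fun v => PC α p ((v - 1) / v)) (nhdsWithin 1 (Ici 1)) (nhds 0) := by
      refine (prim_zero (kC α p) (kC_ii α p _ hα hp1 (by norm_num) (by norm_num))).comp ?_
      refine tendsto_nhdsWithin_iff.2 ⟨?_, ?_⟩
      · have : ContinuousAt (fun v : ℝ => (v - 1) / v) 1 := by fun_prop (disch := norm_num)
        simpa [ContinuousAt] using this.tendsto.mono_left nhdsWithin_le_nhds
      · filter_upwards [self_mem_nhdsWithin] with v hv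
        simp only [mem_Ici] at hv ⊢
        exact div_nonneg (by linarith) (by linarith)
    simpa [ContinuousWithinAt, PC] using this
  exact hc.continuousWithinAt.add (continuousWithinAt_const.mul (hB.sub hC))

lemma alg_top (α p : ℝ) (hα2 : α < 2) :
    Tendsto (fun v : ℝ => -(v ^ (p - 1) * ((v - 1) ^ (α - p + 1) + (1 + v) ^ (α - p + 1))) + (v - 1) ^ α
      + (1 + v) ^ α) atTop (nhds 0) := by
  obtain ⟨C, hC0, hC⟩ := quad_rpow (α - p + 1)
  obtain ⟨D, hD0, hD⟩ := quad_rpow α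
  refine squeeze_zero_norm' (a := fun v : ℝ => (2 * C + 2 * D) * v ^ (-(2 - α))) ?_ ?_
  · filter_upwards [eventually_ge_atTop 2] with v hv
    have h0 : 0 < v := by linarith
    have hx : |v⁻¹| ≤ 1/2 := by
      rw [abs_of_pos (by positivity), one_div]
      exact inv_anti₀ (by norm_num) hv
    have hx' : |-v⁻¹| ≤ 1/2 := by rwa [abs_neg]
    have hxle : v⁻¹ ≤ 1/2 := (le_abs_self _).trans hx
    have b1 := hC _ hx
    have b2 := hC _ hx'
    have b3 := hD _ hx
    have b4 := hD _ hx'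
    have hxp : 0 < v⁻¹ := by positivity
    have e1 : v - 1 = v * (1 + -v⁻¹) := by field_simp; ring
    have e2 : 1 + v = v * (1 + v⁻¹) := by field_simp; ring
    have e3 : v ^ α = v ^ (p - 1) * v ^ (α - p + 1) := by rw [← Real.rpow_add h0]; congr 1; ring
    have e4 : v ^ (-(2 - α)) = v ^ α * v⁻¹ ^ 2 := by
      rw [show -(2 - α) = α - 2 by ring, Real.rpow_sub h0, Real.rpow_two]; field_simp
    rw [e1, e2, Real.mul_rpow h0.le (by linarith), Real.mul_rpow h0.le (by linarith),
      Real.mul_rpow h0.le (by linarith), Real.mul_rpow h0.le (by linarith), e4]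
    rw [show -(v ^ (p - 1) * (v ^ (α - p + 1) * (1 + -v⁻¹) ^ (α - p + 1) + v ^ (α - p + 1) * (1 + v⁻¹) ^ (α - p + 1)))
      + v ^ α * (1 + -v⁻¹) ^ α + v ^ α * (1 + v⁻¹) ^ α = v ^ α * (-((1 + -v⁻¹) ^ (α - p + 1) + (1 + v⁻¹) ^ (α - p + 1))
       + (1 + -v⁻¹) ^ α + (1 + v⁻¹) ^ α) by rw [e3]; ring, norm_mul, Real.norm_of_nonneg (Real.rpow_nonneg h0.le _),
       Real.norm_eq_abs]
    rw [neg_sq] at b2 b4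
    rw [show (2 * C + 2 * D) * (v ^ α * v⁻¹ ^ 2) = v ^ α * ((2 * C + 2 * D) * v⁻¹ ^ 2) by ring]
    refine mul_le_mul_of_nonneg_left ?_ (Real.rpow_nonneg h0.le _)
    rw [abs_le] at b1 b2 b3 b4 ⊢
    constructor <;> linarith
  · simpa using (tendsto_rpow_neg_atTop (by linarith : 0 < 2 - α)).const_mul (2 * C + 2 * D)

lemma W2_top (α p : ℝ) (hα : 0 < α) (hα2 : α < 2) (hp : 0 < p) (hp1 : p < α + 1) :
    Tendsto (W2 α p) atTop (nhds (α * ∫ u in Ioc 0 1, (kB α p u - kC α p u))) := by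
  have hD := kD_int α p hα hα2 hp hp1
  have hii : IntervalIntegrable (fun u => kB α p u - kC α p u) volume 0 1 :=
    (intervalIntegrable_iff_integrableOn_Ioc_of_le zero_le_one).2 hD
  have hu : Tendsto (fun v : ℝ => (v - 1) / v) atTop (nhds 1) := by
    have : Tendsto (fun v : ℝ => 1 - v⁻¹) atTop (nhds 1) := by
      simpa using tendsto_inv_atTop_zero.const_sub (1:ℝ)
    refine this.congr' ?_
    filter_upwards [eventually_gt_atTop 0] with v hv
    field_simp
  have t1 : Tendsto (fun v : ℝ => ∫ u in (0:ℝ)..((v - 1) / v), (kB α p u - kC α p u)) atTop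
      (nhds (∫ u in Ioc 0 1, (kB α p u - kC α p u))) := by
    have hc := intervalIntegral.continuousOn_primitive_interval' (a := 0) hii (by simp) 1 (by simp)
    rw [← intervalIntegral.integral_of_le zero_le_one]
    refine hc.tendsto.comp (tendsto_nhdsWithin_iff.2 ⟨hu, ?_⟩)
    filter_upwards [eventually_gt_atTop 1] with v hv
    rw [uIcc_of_le zero_le_one]
    exact ⟨div_nonneg (by linarith) (by linarith), by rw [div_le_one (by linarith)]; linarith⟩
  obtain ⟨C, hC0, hC⟩ := kB_bound α p
  have t2 : Tendsto (fun v : ℝ => ∫ u in ((v - 1) / v)..(v / (1 + v)), kB α p u) atTop (nhds 0) := by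
    refine squeeze_zero_norm' (a := fun v : ℝ => C * (1 + v) ^ (-(2 - α)) * 2) ?_ ?_
    · filter_upwards [eventually_ge_atTop 2] with v hv
      have h0 : 0 < v := by linarith
      have hY : 0 < 1 + v := by linarith
      have hle : (v - 1) / v ≤ v / (1 + v) := by
        rw [div_le_div_iff₀ h0 hY]; nlinarith
      have hb := intervalIntegral.norm_integral_le_of_norm_le_const (a := (v - 1) / v) (b := v / (1 + v))
        (f := kB α p) (C := C * (1 + v) ^ α) (by
          intro u hu
          rw [uIoc_of_le hle] at hu
          have hu1 : 1/2 ≤ u := by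
            refine le_trans ?_ hu.1.le
            rw [div_le_div_iff₀ (by norm_num) h0]; linarith
          have hu2 : (1 + v)⁻¹ ≤ 1 - u := by
            have := hu.2
            have e : (1 + v)⁻¹ = 1 - v / (1 + v) := by field_simp; ring
            linarith
          have hpos : 0 < (1 + v)⁻¹ := by positivity
          refine (hC u hu1 (by linarith)).trans (mul_le_mul_of_nonneg_left ?_ hC0)
          have := Real.rpow_le_rpow_of_nonpos hpos hu2 (by linarith : -α ≤ 0)
          rwa [Real.inv_rpow hY.le, Real.rpow_neg hY.le, inv_inv] at this)
      refine hb.trans ?_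
      rw [abs_of_nonneg (by linarith), show -(2 - α) = α - 2 by ring, Real.rpow_sub hY, Real.rpow_two,
        mul_assoc, mul_assoc, div_mul_eq_mul_div, mul_div_assoc]
      refine mul_le_mul_of_nonneg_left (mul_le_mul_of_nonneg_left ?_ (Real.rpow_nonneg hY.le _)) hC0
      rw [div_sub_div _ _ hY.ne' h0.ne', div_le_div_iff₀ (by positivity) (by positivity)]
      nlinarith
    · have := (tendsto_rpow_neg_atTop (by linarith : 0 < 2 - α)).comp (tendsto_atTop_add_const_left atTop (1:ℝ) tendsto_id)
      simpa using (this.const_mul C).mul_const 2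
  have t3 := (alg_top α p hα2).add ((t1.add t2).const_mul α)
  simp only [zero_add, add_zero] at t3
  refine t3.congr' ?_
  filter_upwards [eventually_gt_atTop 1] with v hv
  have h0 : 0 < v := by linarith
  have i0 : 0 ≤ (v - 1) / v := div_nonneg (by linarith) h0.le
  have i1 : (v - 1) / v < 1 := by rw [div_lt_one h0]; linarith
  have j0 : 0 ≤ v / (1 + v) := by positivity
  have j1 : v / (1 + v) < 1 := by rw [div_lt_one (by linarith)]; linarith
  have iB := kB_ii α p _ hp i0 i1
  have jB := kB_ii α p _ hp j0 j1
  have iC := kC_ii α p _ hα hp1 i0 i1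
  rw [intervalIntegral.integral_sub iB iC]
  have := intervalIntegral.integral_add_adjacent_intervals iB (iB.symm.trans jB)
  unfold W2 PB PC
  rw [← this]
  ring

lemma JJ_sign (α p : ℝ) : ∃ ε : ℝ, ε ≠ 0 ∧ ∀ v ∈ Ioi (0:ℝ), v ≠ 1 → 0 ≤ ε * ((p - 1) * JJ α p v) := by
  have hle : ∀ v : ℝ, 0 < v → |v - 1| ≤ v + 1 := fun v hv => by
    rw [abs_le]; constructor <;> linarith
  have h : ∃ δ : ℝ, δ ≠ 0 ∧ ∀ v ∈ Ioi (0:ℝ), v ≠ 1 → 0 ≤ δ * JJ α p v := by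
    rcases le_total 0 (α - p) with hs | hs
    · refine ⟨-1, by norm_num, fun v hv hv1 => ?_⟩
      have h1 := Real.rpow_le_rpow (abs_nonneg _) (hle v hv) hs
      have h2 := Real.rpow_nonneg (le_of_lt hv) (p - 2)
      unfold JJ
      nlinarith
    · refine ⟨1, by norm_num, fun v hv hv1 => ?_⟩
      have h1 := Real.rpow_le_rpow_of_nonpos (abs_pos.2 (sub_ne_zero.2 hv1)) (hle v hv) hs
      have h2 := Real.rpow_nonneg (le_of_lt hv) (p - 2)
      unfold JJ
      nlinarith
  obtain ⟨δ, h0, hδ⟩ := h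
  rcases le_total 0 (p - 1) with hs | hs
  · refine ⟨δ, h0, fun v hv hv1 => ?_⟩
    have := mul_nonneg hs (hδ v hv hv1)
    linarith
  · refine ⟨-δ, neg_ne_zero.2 h0, fun v hv hv1 => ?_⟩
    have := mul_nonneg (neg_nonneg.2 hs) (hδ v hv hv1)
    linarith

/-- For `0 < α < 2`, `p ∈ (0, α+1)`, `p ≠ 1`, the coefficient
`γ(α,p) = ((p-1)/α) ∫₀^∞ v^{p-2} (|v-1|^{α-p} - (v+1)^{α-p}) dv` satisfies
`γ(α,p) = ∫₀¹ (u^{p-1} - 1)(1 - u^{α-p}) ((1-u)^{-1-α} + (1+u)^{-1-α}) du`,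
the integral on the right being convergent. -/
theorem stmt2 (α p : ℝ) (hα0 : 0 < α) (hα2 : α < 2)
    (hp0 : 0 < p) (hp1 : p < α + 1) (hpne : p ≠ 1) :
    IntegrableOn
      (fun u : ℝ => (u ^ (p - 1) - 1) * (1 - u ^ (α - p)) *
        ((1 - u) ^ (-1 - α) + (1 + u) ^ (-1 - α))) (Ioo (0 : ℝ) 1) ∧
    (p - 1) / α *
        ∫ v in Ioi (0 : ℝ), v ^ (p - 2) * (|v - 1| ^ (α - p) - (v + 1) ^ (α - p))
      = ∫ u in Ioo (0 : ℝ) 1, (u ^ (p - 1) - 1) * (1 - u ^ (α - p)) *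
          ((1 - u) ^ (-1 - α) + (1 + u) ^ (-1 - α)) := by
  obtain ⟨hAi, hMi, hAe⟩ := kA_Ioi α p hα0 hp0 hp1
  have hD := kD_int α p hα0 hα2 hp0 hp1
  have hD' : IntegrableOn (fun u => kB α p u - kC α p u) (Ioo 0 1) := hD.mono_set Ioo_subset_Ioc_self
  have e : EqOn (fun u : ℝ => (u ^ (p - 1) - 1) * (1 - u ^ (α - p)) * (1 + u) ^ (-1 - α) +
      (kB α p u - kC α p u)) (fun u : ℝ => (u ^ (p - 1) - 1) * (1 - u ^ (α - p)) *
        ((1 - u) ^ (-1 - α) + (1 + u) ^ (-1 - α))) (Ioo 0 1) := by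
    intro u hu
    simp only [kC, kB]
    ring
  refine ⟨(hMi.add hD').congr_fun e measurableSet_Ioo, ?_⟩
  rw [← setIntegral_congr_fun measurableSet_Ioo e, integral_add hMi hD', ← hAe]
  obtain ⟨ε, hε, hs⟩ := JJ_sign α p
  obtain ⟨i1, v1⟩ := ftc_Ioo (W1 α p) (fun v => (p - 1) * JJ α p v) 0 1 _ _ ε one_pos hε
    (fun v hv => W1_deriv α p v hp0 hv.1 hv.2) (fun v hv => hs v hv.1 hv.2.ne)
    (W1_zero α p hα0 hp0) (W1_one α p hα0 hp0 hp1)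
  obtain ⟨i2, v2⟩ := ftc_Ioi (W2 α p) (fun v => (p - 1) * JJ α p v) 1 _ ε hε
    (fun v hv => W2_deriv α p v hα0 hp0 hp1 hv)
    (fun v hv => hs v (mem_Ioi.2 (lt_trans one_pos (mem_Ioi.1 hv))) (ne_of_gt (mem_Ioi.1 hv)))
    (W2_cont α p hα0 hp0 hp1) (W2_top α p hα0 hα2 hp0 hp1)
  have i1' : IntegrableOn (fun v => (p - 1) * JJ α p v) (Ioc 0 1) := by
    rwa [integrableOn_Ioc_iff_integrableOn_Ioo]
  have tot : ∫ v in Ioi (0:ℝ), (p - 1) * JJ α p v =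
      α * ((∫ t in Ioi 0, kA α p t) + ∫ u in Ioo 0 1, (kB α p u - kC α p u)) := by
    rw [← Ioc_union_Ioi_eq_Ioi zero_le_one, setIntegral_union (Ioc_disjoint_Ioi le_rfl)
      measurableSet_Ioi i1' i2, integral_Ioc_eq_integral_Ioo, v1, v2, W2_one α p hα0 hp1,
      integral_Ioc_eq_integral_Ioo, Ioc_union_Ioi_eq_Ioi zero_le_one]
    ring
  rw [integral_const_mul] at tot
  simp only [JJ] at tot
  rw [div_mul_eq_mul_div, tot, mul_div_cancel_left₀ _ hα0.ne']
end

section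
/- Let 0 < α < 2. Then γ(α,1) = ∫₀¹ (1 − u^{α−1})·(ln u)·((1−u)^{−1−α} + (1+u)^{−1−α}) du, where the integral on the right converges. -/
open MeasureTheory Filter Set

lemma aux_glue {F : ℝ → ℝ} (h1 : IntegrableOn F (Ioo 0 (1/2))) (h2 : IntegrableOn F (Ioo (1/2) 1)) :
    IntegrableOn F (Ioo 0 1) := by
  rw [← intervalIntegrable_iff_integrableOn_Ioo_of_le (by norm_num)] at *
  exact h1.trans h2

lemma aux_left {F q r : ℝ → ℝ} (hr : IntervalIntegrable r volume 0 (1/2))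
    (hq : ContinuousOn q (Icc 0 (1/2))) (h : ∀ u ∈ Ioo (0:ℝ) (1/2), q u * r u = F u) :
    IntegrableOn F (Ioo 0 (1/2)) := by
  have := hr.continuousOn_mul (g := q) (by rwa [uIcc_of_le (by norm_num)])
  rw [intervalIntegrable_iff_integrableOn_Ioo_of_le (by norm_num)] at this
  exact this.congr_fun h measurableSet_Ioo

lemma aux_right {F q r : ℝ → ℝ} (hr : IntervalIntegrable r volume (1/2) 1)
    (hq : ContinuousOn q (Icc (1/2) 1)) (h : ∀ u ∈ Ioo (1/2:ℝ) 1, q u * r u = F u) :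
    IntegrableOn F (Ioo (1/2) 1) := by
  have := hr.continuousOn_mul (g := q) (by rwa [uIcc_of_le (by norm_num)])
  rw [intervalIntegrable_iff_integrableOn_Ioo_of_le (by norm_num)] at this
  exact this.congr_fun h measurableSet_Ioo

lemma aux_rpow_right {s : ℝ} (hs : -1 < s) :
    IntervalIntegrable (fun u : ℝ => (1 - u) ^ s) volume (1/2) 1 := by
  have := (intervalIntegral.intervalIntegrable_rpow' (a := 1/2) (b := 0) hs).comp_sub_left 1
  norm_num at this ⊢
  exact this

/-- difference quotient -/
lemma aux_dq (s : ℝ) : ∃ q : ℝ → ℝ, ContinuousOn q (Icc 0 (1/2)) ∧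
    ∀ w ∈ Ioc (0:ℝ) (1/2), (1 - w) ^ s - (1 + w) ^ s = w * q w := by
  have hc : ∀ w ∈ Ioo (-1:ℝ) 1, DifferentiableAt ℝ (fun w : ℝ => (1 - w) ^ s - (1 + w) ^ s) w := by
    intro w hw
    have h1 : (1:ℝ) - w ≠ 0 := by linarith [hw.2]
    have h2 : (1:ℝ) + w ≠ 0 := by linarith [hw.1]
    exact ((differentiableAt_id.const_sub 1).rpow_const (Or.inl h1)).sub
      ((differentiableAt_id.const_add 1).rpow_const (Or.inl h2))
  refine ⟨dslope (fun w : ℝ => (1 - w) ^ s - (1 + w) ^ s) 0, ?_, ?_⟩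
  · have : ContinuousOn (dslope (fun w : ℝ => (1 - w) ^ s - (1 + w) ^ s) 0) (Ioo (-1) 1) := by
      rw [continuousOn_dslope (Ioo_mem_nhds (by norm_num) (by norm_num))]
      exact ⟨fun w hw => (hc w hw).continuousAt.continuousWithinAt, hc 0 (by norm_num)⟩
    exact this.mono (fun x hx => ⟨by linarith [hx.1], by linarith [hx.2]⟩)
  · intro w hw
    rw [dslope_of_ne _ hw.1.ne', slope_def_field]
    have := hw.1.ne'
    simp
    field_simp

/-- difference quotient at 1 -/
lemma aux_dq1 {f : ℝ → ℝ} (hf : ∀ x > 0, DifferentiableAt ℝ f x) (h1 : f 1 = 0) :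
    ∃ q : ℝ → ℝ, ContinuousOn q (Ioi 0) ∧ ∀ w, w ≠ 1 → f w = (1 - w) * q w := by
  refine ⟨fun w => - dslope f 1 w, ?_, ?_⟩
  · apply ContinuousOn.neg
    rw [continuousOn_dslope (Ioi_mem_nhds (by norm_num))]
    exact ⟨fun w hw => (hf w hw).continuousAt.continuousWithinAt, hf 1 (by norm_num)⟩
  · intro w hw
    beta_reduce
    rw [dslope_of_ne _ hw, slope_def_field, h1]
    have : w - 1 ≠ 0 := sub_ne_zero.2 hw
    field_simp
    ring

lemma aux_L (α s : ℝ) (hα0 : 0 < α) (hs : -1 < s) :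
    IntegrableOn (fun w : ℝ => w⁻¹ * ((1 - w) ^ (α - 1) - (1 + w) ^ (α - 1)) * w ^ s) (Ioo 0 1) := by
  apply aux_glue
  · obtain ⟨q, hq, hq'⟩ := aux_dq (α - 1)
    refine aux_left (intervalIntegral.intervalIntegrable_rpow' hs) hq ?_
    intro u hu
    rw [hq' u ⟨hu.1, hu.2.le⟩]
    have := hu.1.ne'
    field_simp
  · have h0 : IntervalIntegrable (fun w : ℝ => (1 - w) ^ (α - 1) - (1 + w) ^ (α - 1)) volume (1/2) 1 := by
      refine (aux_rpow_right (by linarith)).sub (ContinuousOn.intervalIntegrable ?_)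
      rw [uIcc_of_le (by norm_num)]
      intro w hw
      have h2 : (1:ℝ) + w ≠ 0 := by linarith [hw.1]
      exact ((continuousAt_const.add continuousAt_id).rpow_const (Or.inl h2)).continuousWithinAt
    refine aux_right (q := fun w => w⁻¹ * w ^ s) h0 ?_ ?_
    · intro w hw
      have h2 : w ≠ 0 := by linarith [hw.1]
      exact ((continuousAt_inv₀ h2).mul (continuousAt_id.rpow_const (Or.inl h2))).continuousWithinAt
    · intro u hu
      ring

lemma aux_powlog {s : ℝ} (hs : -1 < s) :
    IntervalIntegrable (fun u : ℝ => u ^ s * Real.log u) volume 0 (1/2) := by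
  rw [intervalIntegrable_iff_integrableOn_Ioo_of_le (by norm_num)]
  refine aux_left (q := fun u => Real.log u * u ^ ((s + 1) / 2)) (r := fun u => u ^ ((s - 1)/2))
    (intervalIntegral.intervalIntegrable_rpow' (by linarith)) ?_ ?_
  · intro x hx
    rcases hx.1.eq_or_lt with h | h
    · subst h
      have := tendsto_log_mul_rpow_nhdsGT_zero (r := (s+1)/2) (by linarith)
      have h2 : ContinuousWithinAt (fun u => Real.log u * u ^ ((s + 1) / 2)) (Ioi 0) 0 := by
        simpa [ContinuousWithinAt] using this
      have h3 := continuousWithinAt_insert_self.2 h2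
      exact h3.mono (fun x hx => by
        rcases hx.1.eq_or_lt with h | h
        · left; exact h.symm
        · right; exact h)
    · exact ((Real.continuousAt_log h.ne').mul
        (continuousAt_id.rpow_const (Or.inl h.ne'))).continuousWithinAt
  · intro u hu
    have : u ^ s = u ^ ((s + 1) / 2) * u ^ ((s - 1) / 2) := by
      rw [← Real.rpow_add hu.1]; ring_nf
    simp only [this]; ring

lemma aux_S (α : ℝ) (hα0 : 0 < α) (hα2 : α < 2) : IntegrableOn
      (fun u : ℝ => (1 - u ^ (α - 1)) * Real.log u *
        ((1 - u) ^ (-1 - α) + (1 + u) ^ (-1 - α))) (Ioo (0 : ℝ) 1) := by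
  apply aux_glue
  · have h0 : IntervalIntegrable (fun u : ℝ => u ^ (0:ℝ) * Real.log u - u ^ (α - 1) * Real.log u) volume 0 (1/2) :=
      (aux_powlog (by norm_num)).sub (aux_powlog (by linarith))
    refine aux_left (q := fun u => (1 - u) ^ (-1 - α) + (1 + u) ^ (-1 - α)) h0 ?_ ?_
    · intro w hw
      have h1 : (1:ℝ) - w ≠ 0 := by linarith [hw.2]
      have h2 : (1:ℝ) + w ≠ 0 := by linarith [hw.1]
      exact (((continuousAt_const.sub continuousAt_id).rpow_const (Or.inl h1)).add
        ((continuousAt_const.add continuousAt_id).rpow_const (Or.inl h2))).continuousWithinAt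
    · intro u hu
      simp; ring
  · obtain ⟨q1, hq1, hq1'⟩ := aux_dq1 (f := fun u => 1 - u ^ (α - 1))
      (fun x hx => (differentiableAt_id.rpow_const (Or.inl hx.ne')).const_sub 1) (by simp)
    obtain ⟨q2, hq2, hq2'⟩ := aux_dq1 (f := Real.log)
      (fun x hx => Real.differentiableAt_log hx.ne') (by simp)
    have h0 : IntervalIntegrable (fun w : ℝ => (1 - w) ^ (1 - α) + (1 - w) ^ 2 * (1 + w) ^ (-1 - α)) volume (1/2) 1 := by
      refine (aux_rpow_right (by linarith)).add (ContinuousOn.intervalIntegrable ?_)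
      rw [uIcc_of_le (by norm_num)]
      intro w hw
      have h2 : (1:ℝ) + w ≠ 0 := by linarith [hw.1]
      exact (((continuousAt_const.sub continuousAt_id).pow 2).mul
        ((continuousAt_const.add continuousAt_id).rpow_const (Or.inl h2))).continuousWithinAt
    have hsub : Icc (1/2:ℝ) 1 ⊆ Ioi 0 := fun x hx => by
      have := hx.1
      simp only [mem_Ioi]; linarith
    refine aux_right (q := fun w => q1 w * q2 w) h0 ((hq1.mono hsub).mul (hq2.mono hsub)) ?_
    intro u hu
    have e : (1 - u) ^ (1 - α) = (1 - u) ^ 2 * (1 - u) ^ (-1 - α) := by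
      rw [← Real.rpow_natCast, ← Real.rpow_add (by linarith [hu.2])]
      congr 1; push_cast; ring
    have a1 := hq1' u hu.2.ne
    have a2 := hq2' u hu.2.ne
    beta_reduce at a1
    simp only [e, a1, a2]; ring

noncomputable def auxh (α y : ℝ) : ℝ := (y ^ (α - 1) + y ^ (-α)) / (1 - y)

noncomputable def auxH (α y : ℝ) : ℝ := ∫ t in (1/2:ℝ)..y, auxh α t

noncomputable def auxg (α u : ℝ) : ℝ :=
  (1 - u) ^ (-α) * (1 - u ^ α) - (1 + u) ^ (-α) * (1 + u ^ α)

noncomputable def auxM (α w : ℝ) : ℝ :=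
  -(auxg α w * Real.log w) + auxH α (1 / (1 + w)) - auxH α (1 - w) - auxH α (w / (1 + w))

noncomputable def auxL (α w : ℝ) : ℝ :=
  w⁻¹ * ((1 - w) ^ (α - 1) - (1 + w) ^ (α - 1)) * (1 + w ^ (1 - α))

noncomputable def auxS (α u : ℝ) : ℝ := (1 - u ^ (α - 1)) * Real.log u *
        ((1 - u) ^ (-1 - α) + (1 + u) ^ (-1 - α))

noncomputable def auxX (α w : ℝ) : ℝ := w ^ (α - 1) * (1 - w) ^ (-α)

lemma auxh_cont (α : ℝ) {y : ℝ} (hy : y ∈ Ioo (0:ℝ) 1) : ContinuousAt (auxh α) y := by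
  have h1 : (1:ℝ) - y ≠ 0 := by linarith [hy.2]
  have h2 := hy.1.ne'
  unfold auxh
  exact ((continuousAt_id.rpow_const (Or.inl h2)).add (continuousAt_id.rpow_const (Or.inl h2))).div
    (continuousAt_const.sub continuousAt_id) h1

lemma auxh_int (α : ℝ) {a b : ℝ} (ha : a ∈ Ioo (0:ℝ) 1) (hb : b ∈ Ioo (0:ℝ) 1) :
    IntervalIntegrable (auxh α) volume a b := by
  apply ContinuousOn.intervalIntegrable
  intro y hy
  exact (auxh_cont α (ordConnected_Ioo.uIcc_subset ha hb hy)).continuousWithinAt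

lemma auxH_deriv (α : ℝ) {y : ℝ} (hy : y ∈ Ioo (0:ℝ) 1) : HasDerivAt (auxH α) (auxh α y) y := by
  apply intervalIntegral.integral_hasDerivAt_right (auxh_int α (by norm_num) hy) _ (auxh_cont α hy)
  exact ContinuousOn.stronglyMeasurableAtFilter isOpen_Ioo
    (fun x hx => (auxh_cont α hx).continuousWithinAt) y hy

lemma auxM_deriv (α : ℝ) {w : ℝ} (hw : w ∈ Ioo (0:ℝ) 1) :
    HasDerivAt (auxM α) (auxL α w - α * auxS α w - (auxX α (1 - w) - auxX α w)) w := by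
  obtain ⟨h0, h1⟩ := hw
  have p1 : 0 < 1 - w := by linarith
  have p2 : 0 < 1 + w := by linarith
  have d1 : HasDerivAt (fun w : ℝ => 1 - w) (-1) w := by simpa using (hasDerivAt_id w).const_sub 1
  have d2 : HasDerivAt (fun w : ℝ => 1 + w) 1 w := by simpa using (hasDerivAt_id w).const_add 1
  have d3 := (hasDerivAt_id w)
  have dg : HasDerivAt (auxg α) _ w :=
    ((d1.rpow_const (p := -α) (Or.inl p1.ne')).mul ((d3.rpow_const (p := α) (Or.inl h0.ne')).const_sub 1)).sub
    ((d2.rpow_const (p := -α) (Or.inl p2.ne')).mul ((d3.rpow_const (p := α) (Or.inl h0.ne')).const_add 1))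
  have e1 := (auxH_deriv α (y := 1/(1+w)) ⟨by positivity, by rw [div_lt_one p2]; linarith⟩).comp w
    ((hasDerivAt_const w (1:ℝ)).div d2 p2.ne')
  have e2 := (auxH_deriv α (y := 1 - w) ⟨by linarith, by linarith⟩).comp w d1
  have e3 := (auxH_deriv α (y := w/(1+w)) ⟨by positivity, by rw [div_lt_one p2]; linarith⟩).comp w
    (d3.div d2 p2.ne')
  have key := (((dg.mul (Real.hasDerivAt_log h0.ne')).neg.add e1).sub e2).sub e3
  refine key.congr_deriv ?_
  have q1 : 1 - 1 / (1 + w) = w / (1 + w) := by field_simp; ring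
  have q2 : 1 - w / (1 + w) = 1 / (1 + w) := by field_simp; ring
  simp only [id, auxL, auxS, auxX, auxh, auxg, q1, q2, sub_sub_cancel, Pi.div_apply]
  rw [Real.div_rpow zero_le_one p2.le, Real.div_rpow zero_le_one p2.le, Real.div_rpow h0.le p2.le,
    Real.div_rpow h0.le p2.le]
  have r1 : ∀ x : ℝ, 0 < x → x ^ (-1 - α) = (x ^ α)⁻¹ / x := fun x hx => by
    rw [show -1 - α = -α - 1 by ring, Real.rpow_sub_one hx.ne', Real.rpow_neg hx.le]
  have r2 : ∀ x : ℝ, 0 < x → x ^ (-α - 1) = (x ^ α)⁻¹ / x := fun x hx => by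
    rw [Real.rpow_sub_one hx.ne', Real.rpow_neg hx.le]
  have r3 : ∀ x : ℝ, 0 < x → x ^ (α - 1) = x ^ α / x := fun x hx => Real.rpow_sub_one hx.ne' _
  have r4 : ∀ x : ℝ, 0 < x → x ^ (1 - α) = x / x ^ α := fun x hx => by
    rw [Real.rpow_sub hx, Real.rpow_one]
  have r5 : ∀ x : ℝ, 0 < x → x ^ (-α) = (x ^ α)⁻¹ := fun x hx => Real.rpow_neg hx.le _
  simp only [Real.one_rpow, r1 _ h0, r1 _ p1, r1 _ p2, r2 _ h0, r2 _ p1, r2 _ p2, r3 _ h0, r3 _ p1, r3 _ p2,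
    r4 _ h0, r4 _ p1, r4 _ p2, r5 _ h0, r5 _ p1, r5 _ p2]
  have P0 : 0 < w ^ α := by positivity
  have P1 : 0 < (1 - w) ^ α := by positivity
  have P2 : 0 < (1 + w) ^ α := by positivity
  generalize w ^ α = A at *
  generalize (1 - w) ^ α = B at *
  generalize (1 + w) ^ α = C at *
  generalize Real.log w = l at *
  field_simp
  ring

lemma auxX_cont (α : ℝ) {w : ℝ} (hw : w ∈ Ioo (0:ℝ) 1) : ContinuousAt (auxX α) w := by
  have h1 : (1:ℝ) - w ≠ 0 := by linarith [hw.2]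
  exact (continuousAt_id.rpow_const (Or.inl hw.1.ne')).mul
    ((continuousAt_const.sub continuousAt_id).rpow_const (Or.inl h1))

lemma aux_ftc (α : ℝ) (hT : IntegrableOn (fun w => auxL α w - α * auxS α w) (Ioo 0 1))
    {δ : ℝ} (hδ : δ ∈ Ioo (0:ℝ) (1/2)) :
    ∫ w in δ..(1-δ), (auxL α w - α * auxS α w) = auxM α (1 - δ) - auxM α δ := by
  obtain ⟨h0, h1⟩ := hδ
  have hsub : uIcc δ (1 - δ) ⊆ Ioo 0 1 :=
    ordConnected_Ioo.uIcc_subset ⟨h0, by linarith⟩ ⟨by linarith, by linarith⟩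
  have i1 : IntervalIntegrable (fun w => auxL α w - α * auxS α w) volume δ (1 - δ) := by
    rw [intervalIntegrable_iff]
    exact hT.mono_set (uIoc_subset_uIcc.trans hsub)
  have i2 : IntervalIntegrable (auxX α) volume δ (1 - δ) :=
    ContinuousOn.intervalIntegrable fun x hx => (auxX_cont α (hsub hx)).continuousWithinAt
  have i3 : IntervalIntegrable (fun w => auxX α (1 - w)) volume δ (1 - δ) := by
    have := (i2.comp_sub_left 1).symm
    simpa using this
  have := intervalIntegral.integral_eq_sub_of_hasDerivAt (fun x hx => auxM_deriv α (hsub hx))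
    (i1.sub (i3.sub i2))
  rw [← this, intervalIntegral.integral_sub i1 (i3.sub i2), intervalIntegral.integral_sub i3 i2,
    intervalIntegral.integral_comp_sub_left (auxX α) 1]
  simp

lemma auxh_bound (α : ℝ) {y : ℝ} (hy : y ∈ Ioo (0:ℝ) 1) :
    ‖auxh α y‖ = (y ^ (α + 1) + y ^ (2 - α)) / (y ^ 2 * (1 - y)) := by
  obtain ⟨h0, h1⟩ := hy
  have : 0 < 1 - y := by linarith
  rw [Real.norm_of_nonneg (by unfold auxh; positivity), auxh,
    show α + 1 = (α - 1) + (2:ℕ) by push_cast; ring, show 2 - α = -α + (2:ℕ) by push_cast; ring,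
    Real.rpow_add_natCast h0.ne', Real.rpow_add_natCast h0.ne']
  field_simp

lemma auxH_sub (α : ℝ) {a b : ℝ} (ha : a ∈ Ioo (0:ℝ) 1) (hb : b ∈ Ioo (0:ℝ) 1) :
    auxH α b - auxH α a = ∫ t in a..b, auxh α t := by
  unfold auxH
  rw [intervalIntegral.integral_interval_sub_left] <;> apply auxh_int <;> first | assumption | norm_num

lemma auxH_lim0 (α : ℝ) (hα0 : 0 < α) (hα2 : α < 2) :
    Tendsto (fun δ => auxH α δ - auxH α (δ / (1 + δ))) (nhdsWithin 0 (Ioi 0)) (nhds 0) := by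
  have hlim : Tendsto (fun δ : ℝ => 8 * (δ ^ (α + 1) + δ ^ (2 - α))) (nhdsWithin 0 (Ioi 0)) (nhds 0) := by
    have : ContinuousAt (fun δ : ℝ => 8 * (δ ^ (α + 1) + δ ^ (2 - α))) 0 :=
      continuousAt_const.mul ((continuousAt_id.rpow_const (Or.inr (by linarith))).add
        (continuousAt_id.rpow_const (Or.inr (by linarith))))
    have := this.tendsto.mono_left (nhdsWithin_le_nhds (s := Ioi 0))
    rwa [Real.zero_rpow (by linarith), Real.zero_rpow (by linarith), add_zero, mul_zero] at this
  refine squeeze_zero_norm' ?_ hlim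
  filter_upwards [Ioo_mem_nhdsGT (show (0:ℝ) < 1/2 by norm_num)] with δ hδ
  obtain ⟨h0, h1⟩ := hδ
  have p2 : 0 < 1 + δ := by linarith
  have hle : δ / (1 + δ) ≤ δ := by rw [div_le_iff₀ p2]; nlinarith
  have hlo : δ / 2 ≤ δ / (1 + δ) := by gcongr; linarith
  rw [auxH_sub α ⟨by positivity, by linarith⟩ ⟨h0, by linarith⟩]
  refine (intervalIntegral.norm_integral_le_of_norm_le_const
    (C := 8 * (δ ^ (α + 1) + δ ^ (2 - α)) / δ ^ 2) ?_).trans ?_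
  · intro y hy
    rw [uIoc_of_le hle] at hy
    have y0 : δ / 2 < y := hlo.trans_lt hy.1
    have y1 := hy.2
    have yp : 0 < y := by linarith
    rw [auxh_bound α ⟨yp, by linarith⟩]
    have m1 : y ^ (α + 1) ≤ δ ^ (α + 1) := Real.rpow_le_rpow yp.le y1 (by linarith)
    have m2 : y ^ (2 - α) ≤ δ ^ (2 - α) := Real.rpow_le_rpow yp.le y1 (by linarith)
    have m3 : δ ^ 2 / 8 ≤ y ^ 2 * (1 - y) := by
      have : (δ / 2) ^ 2 ≤ y ^ 2 := by gcongr
      nlinarith [sq_nonneg y]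
    calc _ ≤ (δ ^ (α + 1) + δ ^ (2 - α)) / (δ ^ 2 / 8) := by gcongr
      _ = _ := by field_simp
  · have : |δ - δ / (1 + δ)| ≤ δ ^ 2 := by
      rw [abs_of_nonneg (by linarith), sub_le_iff_le_add, ← sub_le_iff_le_add', le_div_iff₀ p2]
      nlinarith [pow_pos h0 3]
    calc _ ≤ 8 * (δ ^ (α + 1) + δ ^ (2 - α)) / δ ^ 2 * δ ^ 2 := by gcongr
      _ = _ := by field_simp

lemma auxH_lim1 (α : ℝ) (hα0 : 0 < α) (hα2 : α < 2) :
    Tendsto (fun δ => auxH α (1 / (1 + δ)) - auxH α (1 - δ)) (nhdsWithin 0 (Ioi 0)) (nhds 0) := by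
  have hlim : Tendsto (fun δ : ℝ => 16 * δ) (nhdsWithin 0 (Ioi 0)) (nhds 0) := by
    have : ContinuousAt (fun δ : ℝ => 16 * δ) 0 := by fun_prop
    have := this.tendsto.mono_left (nhdsWithin_le_nhds (s := Ioi 0))
    rwa [mul_zero] at this
  refine squeeze_zero_norm' ?_ hlim
  filter_upwards [Ioo_mem_nhdsGT (show (0:ℝ) < 1/2 by norm_num)] with δ hδ
  obtain ⟨h0, h1⟩ := hδ
  have p2 : 0 < 1 + δ := by linarith
  have hle : 1 - δ ≤ 1 / (1 + δ) := by rw [le_div_iff₀ p2]; nlinarith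
  have hhi : 1 / (1 + δ) ≤ 1 - δ / 2 := by rw [div_le_iff₀ p2]; nlinarith
  rw [auxH_sub α ⟨by linarith, by linarith⟩ ⟨by positivity, by linarith⟩]
  refine (intervalIntegral.norm_integral_le_of_norm_le_const
    (C := 16 / δ) ?_).trans ?_
  · intro y hy
    rw [uIoc_of_le hle] at hy
    have y0 : 1 - δ < y := hy.1
    have y1 : y ≤ 1 - δ / 2 := hy.2.trans hhi
    have yp : 0 < y := by linarith
    rw [auxh_bound α ⟨yp, by linarith⟩]
    have m1 : y ^ (α + 1) ≤ 1 := Real.rpow_le_one yp.le (by linarith) (by linarith)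
    have m2 : y ^ (2 - α) ≤ 1 := Real.rpow_le_one yp.le (by linarith) (by linarith)
    have m3 : δ / 8 ≤ y ^ 2 * (1 - y) := by
      have : (1 / 2) ^ 2 ≤ y ^ 2 := by gcongr; linarith
      nlinarith [sq_nonneg y]
    calc _ ≤ (1 + 1) / (δ / 8) := by gcongr
      _ = _ := by field_simp; norm_num
  · have : |1 / (1 + δ) - (1 - δ)| ≤ δ ^ 2 := by
      rw [abs_of_nonneg (by linarith), sub_le_iff_le_add, div_le_iff₀ p2]
      nlinarith [pow_pos h0 3]
    calc _ ≤ 16 / δ * δ ^ 2 := by gcongr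
      _ = _ := by field_simp

lemma auxH_mid (α : ℝ) :
    Tendsto (fun δ => auxH α (1 / (2 - δ)) - auxH α ((1 - δ) / (2 - δ))) (nhdsWithin 0 (Ioi 0)) (nhds 0) := by
  have hc : ContinuousAt (auxH α) (1/2) := (auxH_deriv α (by norm_num)).continuousAt
  have c1 : ContinuousAt (fun δ : ℝ => 1 / (2 - δ)) 0 :=
    continuousAt_const.div (continuousAt_const.sub continuousAt_id) (by norm_num)
  have c2 : ContinuousAt (fun δ : ℝ => (1 - δ) / (2 - δ)) 0 :=
    (continuousAt_const.sub continuousAt_id).div (continuousAt_const.sub continuousAt_id) (by norm_num)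
  have : ContinuousAt (fun δ => auxH α (1 / (2 - δ)) - auxH α ((1 - δ) / (2 - δ))) 0 :=
    (ContinuousAt.comp (g := auxH α) (by simpa using hc) c1).sub
      (ContinuousAt.comp (g := auxH α) (by simpa using hc) c2)
  have := this.tendsto.mono_left (nhdsWithin_le_nhds (s := Ioi 0))
  simpa using this

lemma auxg_lim0 (α : ℝ) (hα0 : 0 < α) :
    Tendsto (fun δ => auxg α δ * Real.log δ) (nhdsWithin 0 (Ioi 0)) (nhds 0) := by
  obtain ⟨q, hq, hq'⟩ := aux_dq (-α)
  have hq0 : Tendsto q (nhdsWithin 0 (Ioi 0)) (nhds (q 0)) := by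
    have := (hq 0 (by norm_num)).tendsto
    rw [nhdsWithin_Icc_eq_nhdsGE (by norm_num)] at this
    exact this.mono_left (nhdsWithin_mono _ Ioi_subset_Ici_self)
  have l1 := tendsto_log_mul_rpow_nhdsGT_zero (r := 1) one_pos
  have l2 := tendsto_log_mul_rpow_nhdsGT_zero hα0
  have hr : Tendsto (fun u : ℝ => (1 - u) ^ (-α) + (1 + u) ^ (-α)) (nhdsWithin 0 (Ioi 0))
      (nhds ((1 - 0) ^ (-α) + (1 + 0) ^ (-α))) := by
    have : ContinuousAt (fun u : ℝ => (1 - u) ^ (-α) + (1 + u) ^ (-α)) 0 :=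
      ((continuousAt_const.sub continuousAt_id).rpow_const (Or.inl (by norm_num))).add
        ((continuousAt_const.add continuousAt_id).rpow_const (Or.inl (by norm_num)))
    exact this.tendsto.mono_left nhdsWithin_le_nhds
  have := (hq0.mul l1).sub (hr.mul l2)
  simp only [mul_zero, sub_zero] at this
  refine this.congr' ?_
  filter_upwards [Ioo_mem_nhdsGT (show (0:ℝ) < 1/2 by norm_num)] with δ hδ
  have e := hq' δ ⟨hδ.1, hδ.2.le⟩
  rw [Real.rpow_one]
  unfold auxg
  linear_combination (-Real.log δ) * e

lemma auxg_lim1 (α : ℝ) (hα2 : α < 2) :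
    Tendsto (fun δ => auxg α (1 - δ) * Real.log (1 - δ)) (nhdsWithin 0 (Ioi 0)) (nhds 0) := by
  obtain ⟨q1, hq1, hq1'⟩ := aux_dq1 (f := fun u => 1 - u ^ α)
    (fun x hx => (differentiableAt_id.rpow_const (Or.inl hx.ne')).const_sub 1) (by simp)
  obtain ⟨q2, hq2, hq2'⟩ := aux_dq1 (f := Real.log)
    (fun x hx => Real.differentiableAt_log hx.ne') (by simp)
  have c0 : ContinuousAt (fun δ : ℝ => 1 - δ) 0 := by fun_prop
  have c1 : ContinuousAt q1 1 := hq1.continuousAt (Ioi_mem_nhds one_pos)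
  have c2 : ContinuousAt q2 1 := hq2.continuousAt (Ioi_mem_nhds one_pos)
  have c : ContinuousAt (fun δ : ℝ => δ ^ (2 - α) * (q1 (1 - δ) * q2 (1 - δ))
      - (2 - δ) ^ (-α) * (1 + (1 - δ) ^ α) * Real.log (1 - δ)) 0 := by
    refine ((continuousAt_id.rpow_const (Or.inr (by linarith))).mul
      ((ContinuousAt.comp (g := q1) (by simpa using c1) c0).mul
       (ContinuousAt.comp (g := q2) (by simpa using c2) c0))).sub
      ((((continuousAt_const.sub continuousAt_id).rpow_const (Or.inl (by norm_num))).mul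
       (continuousAt_const.add (c0.rpow_const (Or.inl (by norm_num))))).mul
       (c0.log (by norm_num)))
  have := c.tendsto.mono_left (nhdsWithin_le_nhds (s := Ioi 0))
  rw [Real.zero_rpow (by linarith)] at this
  simp only [sub_zero, Real.log_one, mul_zero, zero_mul] at this
  refine this.congr' ?_
  filter_upwards [Ioo_mem_nhdsGT (show (0:ℝ) < 1/2 by norm_num)] with δ hδ
  have hne : 1 - δ ≠ 1 := by linarith [hδ.1]
  have a1 := hq1' _ hne
  have a2 := hq2' _ hne
  beta_reduce at a1
  rw [sub_sub_cancel] at a1 a2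
  have e : δ ^ (2 - α) = δ ^ (-α) * δ ^ 2 := by
    rw [← Real.rpow_natCast, ← Real.rpow_add hδ.1]; congr 1; push_cast; ring
  unfold auxg
  rw [sub_sub_cancel, show 1 + (1 - δ) = 2 - δ by ring, sub_mul, a1, e]
  congr 1
  rw [a2]; ring

lemma auxM_lim (α : ℝ) (hα0 : 0 < α) (hα2 : α < 2) :
    Tendsto (fun δ => auxM α (1 - δ) - auxM α δ) (nhdsWithin 0 (Ioi 0)) (nhds 0) := by
  have := ((((auxg_lim0 α hα0).sub (auxg_lim1 α hα2)).add (auxH_mid α)).sub (auxH_lim0 α hα0 hα2)).sub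
    (auxH_lim1 α hα0 hα2)
  simp only [sub_zero, add_zero] at this
  refine this.congr ?_
  intro δ
  unfold auxM
  rw [sub_sub_cancel, show 1 + (1 - δ) = 2 - δ by ring]
  ring

lemma auxL_int (α : ℝ) (hα0 : 0 < α) (hα2 : α < 2) : IntegrableOn (auxL α) (Ioo 0 1) := by
  refine ((aux_L α 0 hα0 (by norm_num)).add (aux_L α (1 - α) hα0 (by linarith))).congr_fun ?_ measurableSet_Ioo
  intro w hw
  simp [auxL]; ring

lemma aux_main (α : ℝ) (hα0 : 0 < α) (hα2 : α < 2) :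
    ∫ w in Ioo (0:ℝ) 1, auxL α w = α * ∫ w in Ioo (0:ℝ) 1, auxS α w := by
  have hL := auxL_int α hα0 hα2
  have hS : IntegrableOn (fun w => α * auxS α w) (Ioo 0 1) := (aux_S α hα0 hα2).const_mul α
  have hT := hL.sub hS
  have hcov : AECover (volume.restrict (Ioo (0:ℝ) 1)) (nhdsWithin (0:ℝ) (Ioi 0)) fun δ => Ioc δ (1 - δ) := by
    apply aecover_Ioo_of_Ioc
    · exact tendsto_id.mono_left nhdsWithin_le_nhds
    · have : ContinuousAt (fun δ : ℝ => 1 - δ) 0 := by fun_prop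
      simpa using this.tendsto.mono_left (nhdsWithin_le_nhds (s := Ioi 0))
  have t1 := hcov.integral_tendsto_of_countably_generated hT
  have t2 := auxM_lim α hα0 hα2
  have : ∫ w in Ioo (0:ℝ) 1, (auxL α w - α * auxS α w) = 0 := by
    refine tendsto_nhds_unique t1 (t2.congr' ?_)
    filter_upwards [Ioo_mem_nhdsGT (show (0:ℝ) < 1/2 by norm_num)] with δ hδ
    rw [← aux_ftc α hT hδ, intervalIntegral.integral_of_le (by linarith [hδ.2]),
      Measure.restrict_restrict measurableSet_Ioc, inter_eq_left.2]
    · rfl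
    · intro x hx
      exact ⟨hδ.1.trans hx.1, by linarith [hx.2, hδ.1]⟩
  rw [integral_sub hL hS, integral_const_mul] at this
  linarith

lemma aux_lhs (α : ℝ) (hα0 : 0 < α) (hα2 : α < 2) :
    ∫ v in Ioi (0 : ℝ), v⁻¹ * (|v - 1| ^ (α - 1) - (v + 1) ^ (α - 1)) =
      ∫ w in Ioo (0:ℝ) 1, auxL α w := by
  set f : ℝ → ℝ := fun v => v⁻¹ * (|v - 1| ^ (α - 1) - (v + 1) ^ (α - 1)) with hf
  have hA := aux_L α 0 hα0 (by norm_num)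
  have hB := aux_L α (1 - α) hα0 (by linarith)
  have e1 : EqOn (fun w : ℝ => w⁻¹ * ((1 - w) ^ (α - 1) - (1 + w) ^ (α - 1)) * w ^ (0:ℝ)) f (Ioo 0 1) := by
    intro w hw
    simp only [hf]
    rw [abs_of_neg (by linarith [hw.2]), neg_sub, Real.rpow_zero, mul_one, add_comm 1 w]
  have himg : (fun x : ℝ => x⁻¹) '' Ioo 0 1 = Ioi 1 := by
    rw [Set.image_inv_eq_inv, Set.inv_Ioo_0_left one_pos]; simp
  have hd : ∀ x ∈ Ioo (0:ℝ) 1, HasDerivWithinAt (fun x : ℝ => x⁻¹) (-(x ^ 2)⁻¹) (Ioo 0 1) x :=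
    fun x hx => (hasDerivAt_inv hx.1.ne').hasDerivWithinAt
  have hinj : InjOn (fun x : ℝ => x⁻¹) (Ioo 0 1) := inv_injective.injOn
  have e2 : EqOn (fun w : ℝ => w⁻¹ * ((1 - w) ^ (α - 1) - (1 + w) ^ (α - 1)) * w ^ (1 - α))
      (fun x => |-(x ^ 2)⁻¹| • f x⁻¹) (Ioo 0 1) := by
    intro w hw
    obtain ⟨h0, h1⟩ := hw
    have p1 : 0 < 1 - w := by linarith
    have p2 : 0 < 1 + w := by linarith
    have q1 : |w⁻¹ - 1| = (1 - w) / w := by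
      rw [show w⁻¹ - 1 = (1 - w) / w by field_simp, abs_of_pos (by positivity)]
    have q2 : w⁻¹ + 1 = (1 + w) / w := by field_simp
    simp only [hf, q1, q2, smul_eq_mul, abs_neg]
    rw [abs_of_pos (by positivity), Real.div_rpow p1.le h0.le, Real.div_rpow p2.le h0.le,
      show 1 - α = -(α - 1) by ring, Real.rpow_neg h0.le, inv_inv]
    have : 0 < w ^ (α - 1) := by positivity
    field_simp
  have i1 : IntegrableOn f (Ioo 0 1) := hA.congr_fun e1 measurableSet_Ioo
  have i2 : IntegrableOn f (Ioi 1) := by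
    rw [← himg, integrableOn_image_iff_integrableOn_abs_deriv_smul measurableSet_Ioo hd hinj]
    exact hB.congr_fun e2 measurableSet_Ioo
  rw [← Ioc_union_Ioi_eq_Ioi zero_le_one, setIntegral_union (by
      rw [Set.disjoint_left]; intro x hx hx'; exact absurd hx.2 (not_le.2 hx')) measurableSet_Ioi
      ((integrableOn_Ioc_iff_integrableOn_Ioo (by simp)).2 i1) i2, integral_Ioc_eq_integral_Ioo,
    ← setIntegral_congr_fun measurableSet_Ioo e1, ← himg,
    integral_image_eq_integral_abs_deriv_smul measurableSet_Ioo hd hinj,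
    ← setIntegral_congr_fun measurableSet_Ioo e2, ← integral_add hA hB]
  refine setIntegral_congr_fun measurableSet_Ioo ?_
  intro w hw
  simp [auxL]; ring

/-- For `0 < α < 2`, the coefficient
`γ(α,1) = (1/α) ∫₀^∞ v⁻¹ (|v-1|^{α-1} - (v+1)^{α-1}) dv` satisfies
`γ(α,1) = ∫₀¹ (1 - u^{α-1}) (ln u) ((1-u)^{-1-α} + (1+u)^{-1-α}) du`,
the integral on the right being convergent. -/
theorem stmt3 (α : ℝ) (hα0 : 0 < α) (hα2 : α < 2) :
    IntegrableOn
      (fun u : ℝ => (1 - u ^ (α - 1)) * Real.log u *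
        ((1 - u) ^ (-1 - α) + (1 + u) ^ (-1 - α))) (Ioo (0 : ℝ) 1) ∧
    1 / α * ∫ v in Ioi (0 : ℝ), v⁻¹ * (|v - 1| ^ (α - 1) - (v + 1) ^ (α - 1))
      = ∫ u in Ioo (0 : ℝ) 1, (1 - u ^ (α - 1)) * Real.log u *
          ((1 - u) ^ (-1 - α) + (1 + u) ^ (-1 - α)) := by
  refine ⟨aux_S α hα0 hα2, ?_⟩
  rw [aux_lhs α hα0 hα2, aux_main α hα0 hα2, one_div, inv_mul_cancel_left₀ hα0.ne']
  rfl
end
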